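/- Let 𝔫 be a finite alphabet. The set T** ⊆ K(𝔫^ℤ) of Toeplitz subshifts over 𝔫 that have growing blocks with respect to the natural factorization of their scale is a Borel subset of K(𝔫^ℤ), and the topological conjugacy relation on T** is hyperfinite: there exists an increasing sequence F_0 ⊆ F_1 ⊆ ⋯ of finite Borel equivalence relations on T** whose union is the relation {(O,O') ∈ T** × T** : O and O' are topologically conjugate}. -/

import Mathlib

open Filter Topology TopologicalSpace Set

/- Endow the product space `𝔫^ℤ` with (a) metric compatible with the product topology, so
that the hyperspace `K(𝔫^ℤ)` carries the Hausdorff metric topology. -/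
attribute [local instance] PiCountable.metricSpace

/-- The Borel σ-algebra on the hyperspace `K(𝔫^ℤ)`. -/
noncomputable local instance (A : Type) [MetricSpace A] :
    MeasurableSpace (NonemptyCompacts (ℤ → A)) := borel _

/-- The left-shift map on bi-infinite sequences. -/
def shiftMap (A : Type) (x : ℤ → A) : ℤ → A := fun i => x (i + 1)

/-- `Per p x` is the set of indices `i` at which `x` is periodic with period `p`. -/
def Per (A : Type) (p : ℕ) (x : ℤ → A) : Set ℤ := {i : ℤ | ∀ k : ℤ, x (i + p * k) = x i}

/-- A sequence is periodic if it is invariant under shifting by some `p ≥ 1`. -/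
def IsPeriodicSeq (A : Type) (x : ℤ → A) : Prop := ∃ p : ℕ, 1 ≤ p ∧ ∀ i : ℤ, x (i + p) = x i

/-- A (non-periodic) Toeplitz sequence: every symbol occurs periodically. -/
def IsToeplitzSeq (A : Type) (x : ℤ → A) : Prop :=
  ¬ IsPeriodicSeq A x ∧ ∀ i : ℤ, ∃ j : ℕ, 1 ≤ j ∧ ∀ k : ℤ, x (i + k * j) = x i

/-- `p` is an essential period of `x`. -/
def IsEssentialPeriod (A : Type) (x : ℤ → A) (p : ℕ) : Prop :=
  1 ≤ p ∧ (Per A p x).Nonempty ∧ ∀ q : ℕ, 1 ≤ q → q < p → Per A p x ≠ Per A q x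

/-- The closure of the forward `σ`-orbit of `x`. -/
def orbitClosure (A : Type) [TopologicalSpace A] (x : ℤ → A) : Set (ℤ → A) :=
  closure {y | ∃ n : ℕ, y = (shiftMap A)^[n] x}

/-- Topological conjugacy of two subshifts: a shift-commuting homeomorphism. -/
def IsTopConj (A : Type) [TopologicalSpace A] (O O' : Set (ℤ → A)) : Prop :=
  ∃ e : O ≃ₜ O', ∀ x y : O, (y : ℤ → A) = shiftMap A (x : ℤ → A) →
    (e y : ℤ → A) = shiftMap A (e x : ℤ → A)

/-- The `t`-th term `ṙ_t = ∏_{1 ≤ i ≤ t+1} p_i^{min(k_i, t+1)}` of the approximating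
sequence to the scale of `x`, where `p_1 < p_2 < ⋯` are the primes and
`k_i = sup {j : p_i^j divides some essential period of x}`. -/
noncomputable def rdot (A : Type) (x : ℤ → A) (t : ℕ) : ℕ :=
  ∏ i ∈ Finset.range (t + 1),
    (Nat.nth Nat.Prime i) ^
      sSup {j : ℕ | j ≤ t + 1 ∧ ∃ e : ℕ, IsEssentialPeriod A x e ∧ (Nat.nth Nat.Prime i) ^ j ∣ e}

/-- The natural factorization of the scale of `x`: the sequence `(ṙ_t)` with all `1`'s and
all repeated terms deleted, i.e. the increasing enumeration of its set of values `≠ 1`. -/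
noncomputable def natFactorization (A : Type) (x : ℤ → A) : ℕ → ℕ :=
  Nat.nth fun m => m ≠ 1 ∧ ∃ t : ℕ, rdot A x t = m

/-- `x` has growing blocks with respect to `(u_i)`: the minimal length of a maximal block
of consecutive indices contained in `Per_{u_i}(x)` tends to `∞` with `i`. -/
def HasGrowingBlocks (A : Type) (x : ℤ → A) (u : ℕ → ℕ) : Prop :=
  ∀ N : ℤ, ∃ I : ℕ, ∀ i : ℕ, I ≤ i → ∀ a b : ℤ, a ≤ b →
    (∀ j : ℤ, a ≤ j → j ≤ b → j ∈ Per A (u i) x) →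
    (a - 1) ∉ Per A (u i) x → (b + 1) ∉ Per A (u i) x → N ≤ b - a + 1

/-- `T**`: the set of Toeplitz subshifts having growing blocks with respect to the natural
factorization of their scale, inside `K(𝔫^ℤ)`. -/
def ToeplitzGrowingBlocks (A : Type) [MetricSpace A] : Set (NonemptyCompacts (ℤ → A)) :=
  {K | ∃ x : ℤ → A, IsToeplitzSeq A x ∧ (K : Set (ℤ → A)) = orbitClosure A x ∧
    HasGrowingBlocks A x (natFactorization A x)}

section Sequences

variable {A : Type}

/-- The shift of a bi-infinite sequence by an arbitrary integer. -/
def shiftBy (k : ℤ) (x : ℤ → A) : ℤ → A := fun i => x (i + k)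

lemma shiftMap_iterate (n : ℕ) (x : ℤ → A) : (shiftMap A)^[n] x = shiftBy n x := by
  induction n with
  | zero => ext i; simp [shiftBy]
  | succ n ih =>
    rw [Function.iterate_succ_apply', ih]
    ext i
    simp only [shiftMap, shiftBy]
    push_cast
    congr 1
    ring

lemma shiftBy_shiftBy (k l : ℤ) (x : ℤ → A) : shiftBy k (shiftBy l x) = shiftBy (k + l) x := by
  ext i
  simp only [shiftBy, add_assoc]

lemma shiftMap_eq_shiftBy (x : ℤ → A) : shiftMap A x = shiftBy 1 x := rfl

lemma mem_Per_shiftBy {p : ℕ} {k i : ℤ} {x : ℤ → A} :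
    i ∈ Per A p (shiftBy k x) ↔ i + k ∈ Per A p x := by
  simp only [Per, shiftBy, Set.mem_ofPred_eq, add_right_comm]

lemma add_mul_mem_Per {p : ℕ} {i : ℤ} {x : ℤ → A} (h : i ∈ Per A p x) (k : ℤ) :
    i + p * k ∈ Per A p x := by
  intro l
  rw [h k, add_assoc, ← mul_add, h]

lemma add_mul_mem_Per_iff {p : ℕ} {i : ℤ} {x : ℤ → A} (k : ℤ) :
    i + p * k ∈ Per A p x ↔ i ∈ Per A p x := by
  refine ⟨fun h => ?_, fun h => add_mul_mem_Per h k⟩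
  simpa [add_assoc] using add_mul_mem_Per h (-k)

lemma Per_subset_of_dvd {p q : ℕ} (h : p ∣ q) (x : ℤ → A) : Per A p x ⊆ Per A q x := by
  obtain ⟨c, rfl⟩ := h
  intro i hi k
  have := hi (c * k)
  push_cast
  rwa [mul_assoc]

lemma Per_eq_of_subset_of_translate {r : ℕ} (hr : 0 < r) {x y : ℤ → A}
    (hsub : Per A r x ⊆ Per A r y) {d : ℤ} (hd : ∀ i, i ∈ Per A r y ↔ i + d ∈ Per A r x) :
    Per A r x = Per A r y := by
  refine hsub.antisymm fun i hi => ?_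
  have key : ∀ n : ℕ, i + (n + 1 : ℕ) * d ∈ Per A r x := by
    intro n
    induction n with
    | zero => simpa using (hd i).1 hi
    | succ n ih =>
      have := (hd _).1 (hsub ih)
      convert this using 1
      push_cast
      ring
  have h1 := key (r - 1)
  rw [Nat.sub_add_cancel hr] at h1
  exact (add_mul_mem_Per_iff d).1 h1

lemma IsEssentialPeriod.dvd_of_translate {x : ℤ → A} {e j : ℕ} (he : IsEssentialPeriod A x e)
    (hj : ∀ i ∈ Per A e x, i + j ∈ Per A e x ∧ x (i + j) = x i) : e ∣ j := by
  obtain ⟨he1, -, hmin⟩ := he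
  have nat : ∀ n : ℕ, ∀ i ∈ Per A e x, i + j * n ∈ Per A e x ∧ x (i + j * n) = x i := by
    intro n i hi
    induction n with
    | zero => simpa using hi
    | succ n ih =>
      have := hj _ ih.1
      rw [ih.2] at this
      have h2 : i + (j : ℤ) * (n + 1 : ℕ) = i + j * n + j := by push_cast; ring
      rwa [h2]
  have int : ∀ b : ℤ, ∀ i ∈ Per A e x, i + j * b ∈ Per A e x ∧ x (i + j * b) = x i := by
    intro b i hi
    obtain ⟨n, hn⟩ : ∃ n : ℕ, (n : ℤ) = b + e * |b| := by
      refine ⟨(b + e * |b|).toNat, Int.toNat_of_nonneg ?_⟩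
      have h1 : (1 : ℤ) ≤ e := by exact_mod_cast he1
      have h2 := neg_abs_le b
      nlinarith [abs_nonneg b]
    have h := nat n i hi
    have h2 : i + (j : ℤ) * b = i + j * n + e * (-(j * |b|)) := by rw [hn]; ring
    rw [h2]
    exact ⟨add_mul_mem_Per h.1 _, by rw [h.1, h.2]⟩
  have hsub : Per A e x ⊆ Per A (Nat.gcd e j) x := by
    intro i hi k
    have h2 : i + (Nat.gcd e j : ℕ) * k
        = i + j * (Nat.gcdB e j * k) + e * (Nat.gcdA e j * k) := by
      rw [Nat.gcd_eq_gcd_ab]; ring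
    have h := int (Nat.gcdB e j * k) i hi
    rw [h2, h.1, h.2]
  have hd : 1 ≤ Nat.gcd e j := Nat.gcd_pos_of_pos_left _ he1
  have hle : Nat.gcd e j ≤ e := Nat.le_of_dvd he1 (Nat.gcd_dvd_left e j)
  rcases hle.lt_or_eq with hlt | heq
  · exact absurd (hsub.antisymm (Per_subset_of_dvd (Nat.gcd_dvd_left e j) x)) (hmin _ hd hlt)
  · exact Nat.gcd_eq_left_iff_dvd.1 heq

lemma exists_isEssentialPeriod {p : ℕ} (hp : 1 ≤ p) {x : ℤ → A} (h : (Per A p x).Nonempty) :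
    ∃ q, IsEssentialPeriod A x q ∧ Per A q x = Per A p x := by
  classical
  have hex : ∃ q, 1 ≤ q ∧ Per A q x = Per A p x := ⟨p, hp, rfl⟩
  refine ⟨Nat.find hex, ⟨(Nat.find_spec hex).1, ?_, fun q hq hlt heq => ?_⟩,
    (Nat.find_spec hex).2⟩
  · rwa [(Nat.find_spec hex).2]
  · exact Nat.find_min hex hlt ⟨hq, heq.symm.trans (Nat.find_spec hex).2⟩

/-- A window determines the `r`-skeleton among all sequences whose `r`-skeletons are translates
of each other. -/
lemma exists_window {r : ℕ} (hr : 0 < r) (x : ℤ → A) :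
    ∃ N : ℕ, ∀ y : ℤ → A, (∀ i : ℤ, -N ≤ i → i ≤ N → y i = x i) →
      (∃ d, ∀ i, i ∈ Per A r x ↔ i + d ∈ Per A r y) →
      Per A r y = Per A r x ∧ ∀ i ∈ Per A r x, y i = x i := by
  classical
  have hw : ∀ i : ℤ, ∃ k : ℤ, i ∉ Per A r x → x (i + r * k) ≠ x i := by
    intro i
    by_cases hi : i ∈ Per A r x
    · exact ⟨0, fun h => absurd hi h⟩
    · simp only [Per, Set.mem_ofPred_eq, not_forall] at hi
      obtain ⟨k, hk⟩ := hi
      exact ⟨k, fun _ => hk⟩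
  choose k hk using hw
  have hr' : (0 : ℤ) < r := by exact_mod_cast hr
  refine ⟨r + ∑ i ∈ Finset.range r, ((i : ℤ) + r * k i).natAbs, fun y hy ⟨d, hd⟩ => ?_⟩
  have hres : ∀ i : ℤ, ∃ j : ℕ, j < r ∧ i = j + r * (i / r) := by
    intro i
    refine ⟨(i % r).toNat, ?_, ?_⟩
    · have := Int.emod_lt_of_pos i hr'
      have := Int.emod_nonneg i hr'.ne'
      omega
    · rw [Int.toNat_of_nonneg (Int.emod_nonneg i hr'.ne'), Int.emod_add_mul_ediv]
  have hsmall : ∀ j : ℕ, j < r → y j = x j := fun j hj => hy _ (by omega) (by omega)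
  have hsub : Per A r y ⊆ Per A r x := by
    intro i hi
    obtain ⟨j, hj, hij⟩ := hres i
    rw [hij, add_mul_mem_Per_iff] at hi ⊢
    by_contra hcon
    refine hk j hcon ?_
    have hle : ((j : ℤ) + r * k j).natAbs ≤
        ∑ i ∈ Finset.range r, ((i : ℤ) + r * k i).natAbs :=
      Finset.single_le_sum (f := fun i : ℕ => ((i : ℤ) + r * k i).natAbs)
        (fun _ _ => Nat.zero_le _) (Finset.mem_range.2 hj)
    rw [← hy _ (by omega) (by omega), ← hsmall j hj]
    exact hi _
  have heq := Per_eq_of_subset_of_translate hr hsub hd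
  refine ⟨heq, fun i hi => ?_⟩
  obtain ⟨j, hj, hij⟩ := hres i
  rw [hij, add_mul_mem_Per_iff] at hi
  rw [hij, hi, (heq ▸ hi : (j : ℤ) ∈ Per A r y), hsmall j hj]

lemma IsToeplitzSeq.exists_period {x : ℤ → A} (hx : IsToeplitzSeq A x) (s : Finset ℤ) :
    ∃ p : ℕ, 1 ≤ p ∧ ∀ i ∈ s, i ∈ Per A p x := by
  classical
  induction s using Finset.induction_on with
  | empty => exact ⟨1, le_rfl, by simp⟩
  | insert a s _ ih =>
    obtain ⟨p, hp, hs⟩ := ih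
    obtain ⟨q, hq, ha⟩ := hx.2 a
    refine ⟨p * q, Nat.mul_pos hp hq, fun i hi => ?_⟩
    rcases Finset.mem_insert.1 hi with rfl | hi
    · exact Per_subset_of_dvd (Dvd.intro_left p rfl) x fun k => by rw [mul_comm]; exact ha k
    · exact Per_subset_of_dvd (Dvd.intro q rfl) x (hs i hi)

lemma IsToeplitzSeq.shift {x : ℤ → A} (hx : IsToeplitzSeq A x) (k : ℤ) :
    IsToeplitzSeq A (shiftBy k x) := by
  refine ⟨fun ⟨p, hp, h⟩ => hx.1 ⟨p, hp, fun i => ?_⟩, fun i => ?_⟩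
  · have := h (i - k)
    simp only [shiftBy] at this
    convert this using 2 <;> ring
  · obtain ⟨j, hj, h⟩ := hx.2 (i + k)
    refine ⟨j, hj, fun l => ?_⟩
    simp only [shiftBy, add_right_comm]
    exact h l

/-- `y` is obtained from `x` by a local rule of radius `m`, as far as repetitions are
concerned. -/
def Tracks (m : ℕ) (x y : ℤ → A) : Prop :=
  ∀ i k : ℤ, (∀ j, i - m ≤ j → j ≤ i + m → x (j + k) = x j) → y (i + k) = y i

lemma Tracks.mem_Per {m r : ℕ} {x y : ℤ → A} (h : Tracks m x y) {i : ℤ}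
    (hi : ∀ j, i - m ≤ j → j ≤ i + m → j ∈ Per A r x) : i ∈ Per A r y :=
  fun k => h i _ fun j h1 h2 => hi j h1 h2 k

lemma Tracks.exists_essential_dvd {m : ℕ} {w x : ℤ → A} (h : Tracks m w x)
    (hw : IsToeplitzSeq A w) {e : ℕ} (he : IsEssentialPeriod A x e) :
    ∃ e', IsEssentialPeriod A w e' ∧ e ∣ e' := by
  obtain ⟨N, hN⟩ := exists_window he.1 x
  obtain ⟨p, hp, hper⟩ := hw.exists_period (Finset.Icc (-(N + m : ℤ)) (N + m))
  obtain ⟨e', he', heq⟩ := exists_isEssentialPeriod hp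
    ⟨0, hper 0 (Finset.mem_Icc.2 ⟨by omega, by omega⟩)⟩
  have hagree : ∀ i : ℤ, -N ≤ i → i ≤ N → shiftBy e' x i = x i := by
    refine fun i hi1 hi2 => h i e' fun j hj1 hj2 => ?_
    have : j ∈ Per A e' w := heq ▸ hper j (Finset.mem_Icc.2 ⟨by omega, by omega⟩)
    simpa using this 1
  obtain ⟨h1, h2⟩ := hN (shiftBy e' x) hagree
    ⟨-e', fun i => by rw [mem_Per_shiftBy, neg_add_cancel_right]⟩
  exact ⟨e', he', he.dvd_of_translate fun i hi => ⟨mem_Per_shiftBy.1 (h1 ▸ hi), h2 i hi⟩⟩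

lemma rdot_congr {x y : ℤ → A}
    (hxy : ∀ e, IsEssentialPeriod A x e → ∃ e', IsEssentialPeriod A y e' ∧ e ∣ e')
    (hyx : ∀ e, IsEssentialPeriod A y e → ∃ e', IsEssentialPeriod A x e' ∧ e ∣ e') (t : ℕ) :
    rdot A x t = rdot A y t := by
  have key : ∀ q : ℕ, (∃ e, IsEssentialPeriod A x e ∧ q ∣ e) ↔
      ∃ e, IsEssentialPeriod A y e ∧ q ∣ e := by
    refine fun q => ⟨fun ⟨e, he, hq⟩ => ?_, fun ⟨e, he, hq⟩ => ?_⟩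
    · obtain ⟨e', he', h⟩ := hxy e he
      exact ⟨e', he', hq.trans h⟩
    · obtain ⟨e', he', h⟩ := hyx e he
      exact ⟨e', he', hq.trans h⟩
  simp only [rdot, key]

/-- The positions at which a maximal run outside `Per r x` starts. -/
def GapStart (r : ℕ) (x : ℤ → A) : Set ℤ := {s | s - 1 ∈ Per A r x ∧ s ∉ Per A r x}

lemma GapStart_congr {r : ℕ} {x y : ℤ → A} (h : Per A r x = Per A r y) :
    GapStart r x = GapStart r y := by
  simp only [GapStart, h]

lemma add_mul_mem_GapStart {r : ℕ} {x : ℤ → A} {s : ℤ} (hs : s ∈ GapStart r x) (k : ℤ) :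
    s + r * k ∈ GapStart r x := by
  refine ⟨?_, fun h => hs.2 ((add_mul_mem_Per_iff k).1 h)⟩
  rw [add_sub_right_comm]
  exact add_mul_mem_Per hs.1 k

lemma mem_GapStart_shiftBy {r : ℕ} {x : ℤ → A} {k s : ℤ} :
    s ∈ GapStart r (shiftBy k x) ↔ s + k ∈ GapStart r x := by
  simp only [GapStart, Set.mem_ofPred_eq, mem_Per_shiftBy, add_sub_right_comm]

lemma exists_mem_GapStart {r : ℕ} (hr : 0 < r) {x : ℤ → A} {i j : ℤ} (hi : i ∈ Per A r x)
    (hj : j ∉ Per A r x) : (GapStart r x).Nonempty := by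
  by_contra hcon
  have step : ∀ n : ℕ, i + n ∈ Per A r x := by
    intro n
    induction n with
    | zero => simpa using hi
    | succ n ih =>
      by_contra h
      exact hcon ⟨i + (n + 1 : ℕ), by push_cast; rwa [← add_assoc, add_sub_cancel_right], h⟩
  have hr' : (1 : ℤ) ≤ r := by exact_mod_cast hr
  obtain ⟨n, hn⟩ : ∃ n : ℕ, (n : ℤ) = j + r * |i - j| - i :=
    ⟨(j + r * |i - j| - i).toNat, Int.toNat_of_nonneg (by
      nlinarith [le_abs_self (i - j), abs_nonneg (i - j)])⟩
  have := step n
  rw [hn, add_sub_cancel, add_mul_mem_Per_iff] at this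
  exact hj this

/-- Every run of `Per r x` that ends has length at least `L`. -/
def LongBlocks (L r : ℕ) (x : ℤ → A) : Prop :=
  ∀ s ∈ GapStart r x, ∀ i, s - L ≤ i → i < s → i ∈ Per A r x

/-- `r`-equivariant self-maps of `ℤ`. -/
def Equivariant (r : ℕ) : Type := {h : ℤ → ℤ // ∀ i, h (i + r) = h i + r}

lemma Equivariant.apply_add_mul {r : ℕ} (h : Equivariant r) (i k : ℤ) :
    h.1 (i + r * k) = h.1 i + r * k := by
  induction k using Int.induction_on with
  | zero => simp
  | succ n ih => rw [mul_add, mul_one, ← add_assoc, h.2, ih, add_assoc]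
  | pred n ih =>
    have := h.2 (i + r * (-n - 1))
    rw [show i + (r : ℤ) * (-n - 1) + r = i + r * -n by ring, ih] at this
    linarith

lemma countable_equivariant {r : ℕ} (hr : 0 < r) : Countable (Equivariant r) := by
  have hr' : (0 : ℤ) < r := by exact_mod_cast hr
  refine Function.Injective.countable (f := fun (h : Equivariant r) (j : Fin r) => h.1 j) ?_
  intro h h' heq
  refine Subtype.ext (funext fun i => ?_)
  have h0 := Int.emod_nonneg i hr'.ne'
  have h1 := Int.emod_lt_of_pos i hr'
  have := congrFun heq ⟨(i % r).toNat, by omega⟩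
  simp only [Int.toNat_of_nonneg h0] at this
  rw [← Int.emod_add_mul_ediv i r, h.apply_add_mul, h'.apply_add_mul, this]

/-- `h` maps gap starts of `x` to gap starts of `y` so that repetitions with step `r` between gap
starts of `x` correspond to repetitions between their images. -/
def BlockMap (r : ℕ) (h : ℤ → ℤ) (x y : ℤ → A) : Prop :=
  (∀ s ∈ GapStart r x, h s ∈ GapStart r y) ∧
  ∀ s ∈ GapStart r x, ∀ s' ∈ GapStart r x, s < s' → ∀ n : ℤ,
    ((∀ i, s ≤ i → i < s' → x (i + r * n) = x i) ↔
      ∀ i, h s ≤ i → i < h s' → y (i + r * n) = y i)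

/-- There is an equivariant block map from `x` to `y`. -/
def BlockConj (r : ℕ) (x y : ℤ → A) : Prop := ∃ h : Equivariant r, BlockMap r h.1 x y

lemma BlockMap.lt {r : ℕ} {h : ℤ → ℤ} {x y : ℤ → A} (H : BlockMap r h x y) {s s' : ℤ}
    (hs : s ∈ GapStart r x) (hs' : s' ∈ GapStart r x) (hlt : s < s') : h s < h s' := by
  by_contra hcon
  exact hs.2 fun n => (H.2 s hs s' hs' hlt n).2 (fun i h1 h2 => by omega) s le_rfl hlt

lemma BlockConj.trans {r : ℕ} {x y z : ℤ → A} (hxy : BlockConj r x y) (hyz : BlockConj r y z) :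
    BlockConj r x z := by
  obtain ⟨h, H⟩ := hxy
  obtain ⟨g, G⟩ := hyz
  refine ⟨⟨g.1 ∘ h.1, fun i => by simp [h.2, g.2]⟩, fun s hs => G.1 _ (H.1 s hs), ?_⟩
  intro s hs s' hs' hlt n
  exact (H.2 s hs s' hs' hlt n).trans (G.2 _ (H.1 s hs) _ (H.1 s' hs') (H.lt hs hs' hlt) n)

lemma BlockMap.shift {r : ℕ} {h : ℤ → ℤ} {x y : ℤ → A} (H : BlockMap r h x y) (k : ℤ) :
    BlockMap r (fun i => h (i + k) - k) (shiftBy k x) (shiftBy k y) := by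
  have aux : ∀ (a b n : ℤ) (z : ℤ → A),
      (∀ i, a ≤ i → i < b → shiftBy k z (i + r * n) = shiftBy k z i) ↔
      ∀ i, a + k ≤ i → i < b + k → z (i + r * n) = z i := by
    refine fun a b n z => ⟨fun H i h1 h2 => ?_, fun H i h1 h2 => ?_⟩
    · have := H (i - k) (by omega) (by omega)
      simp only [shiftBy] at this
      convert this using 2 <;> ring
    · have := H (i + k) (by omega) (by omega)
      simp only [shiftBy]
      convert this using 2
      ring
  refine ⟨fun s hs => ?_, fun s hs s' hs' hlt n => ?_⟩
  · rw [mem_GapStart_shiftBy] at hs ⊢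
    rw [sub_add_cancel]
    exact H.1 _ hs
  · rw [mem_GapStart_shiftBy] at hs hs'
    rw [aux, aux, sub_add_cancel, sub_add_cancel]
    exact H.2 _ hs _ hs' (by omega) n

lemma Tracks.repeat_between {m r : ℕ} {x y : ℤ → A} (h : Tracks m x y)
    (hx : LongBlocks (2 * m + 1) r x) (hy : LongBlocks (2 * m + 1) r y) {s s' u u' : ℤ}
    (hs : s ∈ GapStart r x) (hu' : u' ∈ GapStart r y)
    (hsu : |s - u| ≤ m) (hsu' : |s' - u'| ≤ m) {n : ℤ}
    (H : ∀ i, s ≤ i → i < s' → x (i + r * n) = x i) :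
    ∀ i, u ≤ i → i < u' → y (i + r * n) = y i := by
  intro i h1 h2
  rw [abs_le] at hsu hsu'
  by_cases hi : u' - (2 * m + 1 : ℕ) ≤ i
  · exact hy u' hu' i hi h2 n
  · push_cast at hi
    refine h i _ fun j hj1 hj2 => ?_
    by_cases hj : s ≤ j
    · exact H j hj (by omega)
    · exact hx s hs j (by push_cast; omega) (by omega) n

lemma LongBlocks.eq_of_near {m r : ℕ} {y : ℤ → A} (hy : LongBlocks (2 * m + 1) r y) {s u u' : ℤ}
    (hu : u ∈ GapStart r y) (hu' : u' ∈ GapStart r y) (h : |s - u| ≤ m) (h' : |s - u'| ≤ m) :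
    u = u' := by
  rw [abs_le] at h h'
  rcases lt_trichotomy u u' with hlt | heq | hlt
  · exact absurd (hy u' hu' u (by push_cast; omega) hlt) hu.2
  · exact heq
  · exact absurd (hy u hu u' (by push_cast; omega) hlt) hu'.2

lemma Tracks.exists_near_GapStart {m r : ℕ} {x y : ℤ → A} (hxy : Tracks m x y)
    (hyx : Tracks m y x) (hx : LongBlocks (2 * m + 1) r x) {s : ℤ} (hs : s ∈ GapStart r x) :
    ∃ u ∈ GapStart r y, |s - u| ≤ m := by
  have h0 : s - m - 1 ∈ Per A r y := hxy.mem_Per fun j h1 h2 =>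
    hx s hs j (by push_cast; omega) (by omega)
  by_contra! hcon
  have step : ∀ n : ℕ, n ≤ 2 * m + 1 → s - m - 1 + n ∈ Per A r y := by
    intro n
    induction n with
    | zero => intro _; simpa using h0
    | succ n ih =>
      intro hn
      by_contra h
      have := hcon (s - m - 1 + (n + 1 : ℕ))
        ⟨by push_cast; rw [← add_assoc, add_sub_cancel_right]; exact ih (by omega), h⟩
      exact absurd this (not_lt.2 (abs_le.2 ⟨by push_cast; omega, by push_cast; omega⟩))
  refine hs.2 (hyx.mem_Per fun j h1 h2 => ?_)
  have := step (j - (s - m - 1)).toNat (by omega)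
  rwa [Int.toNat_of_nonneg (by omega), add_sub_cancel] at this

/-- Mutually local sequences with long enough blocks are related by a block map: send each gap
start to the nearest one. -/
lemma Tracks.blockConj {m r : ℕ} {x y : ℤ → A} (hxy : Tracks m x y)
    (hyx : Tracks m y x) (hx : LongBlocks (2 * m + 1) r x) (hy : LongBlocks (2 * m + 1) r y) :
    BlockConj r x y := by
  classical
  have hex : ∀ s, ∃ u, (s ∈ GapStart r x → u ∈ GapStart r y ∧ |s - u| ≤ m) ∧
      (s ∉ GapStart r x → u = s) := by
    intro s
    by_cases hs : s ∈ GapStart r x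
    · obtain ⟨u, hu, h⟩ := hxy.exists_near_GapStart hyx hx hs
      exact ⟨u, fun _ => ⟨hu, h⟩, fun h => absurd hs h⟩
    · exact ⟨s, fun h => absurd h hs, fun _ => rfl⟩
  choose h h1 h2 using hex
  refine ⟨⟨h, fun i => ?_⟩, fun s hs => (h1 s hs).1, fun s hs s' hs' _ n => ⟨?_, ?_⟩⟩
  · by_cases hi : i ∈ GapStart r x
    · have hi' : i + r ∈ GapStart r x := by simpa using add_mul_mem_GapStart hi 1
      have hg : h i + r ∈ GapStart r y := by simpa using add_mul_mem_GapStart (h1 i hi).1 1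
      refine hy.eq_of_near (h1 _ hi').1 hg (h1 _ hi').2 ?_
      rw [add_sub_add_right_eq_sub]
      exact (h1 i hi).2
    · have hi' : i + r ∉ GapStart r x := fun hcon => hi (by
        simpa using add_mul_mem_GapStart hcon (-1))
      rw [h2 i hi, h2 _ hi']
  · exact hxy.repeat_between hx hy hs (h1 s' hs').1 (h1 s hs).2 (h1 s' hs').2
  · refine hyx.repeat_between hy hx (h1 s hs).1 hs' ?_ ?_
    · rw [abs_sub_comm]; exact (h1 s hs).2
    · rw [abs_sub_comm]; exact (h1 s' hs').2

/-- The sequence obtained from `x` by applying `φ` to its consecutive blocks of length `r`. -/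
def blockRecode {r : ℕ} (hr : 0 < r) (s : ℤ) (x : ℤ → A) (φ : (Fin r → A) → (Fin r → A)) :
    ℤ → A := fun i =>
  φ (fun j => x (s + j + r * (i / r))) ⟨(i % r).toNat, by
    have h1 := Int.emod_lt_of_pos i (by exact_mod_cast hr : (0 : ℤ) < r)
    have h2 := Int.emod_nonneg i (by exact_mod_cast hr.ne' : (r : ℤ) ≠ 0)
    omega⟩

lemma BlockConj.exists_blockRecode {r : ℕ} (hr : 0 < r) {x y : ℤ → A} (H : BlockConj r x y)
    {s : ℤ} (hs : s ∈ GapStart r x) : ∃ φ k, shiftBy k y = blockRecode hr s x φ := by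
  classical
  obtain ⟨h, H⟩ := H
  have hr' : (0 : ℤ) < r := by exact_mod_cast hr
  let X : ℤ → Fin r → A := fun n j => x (s + j + r * n)
  let Y : ℤ → Fin r → A := fun n j => y (h.1 s + j + r * n)
  have key : ∀ n n', X n = X n' → Y n = Y n' := by
    intro n n' heq
    have hn := add_mul_mem_GapStart hs n
    have hn' := add_mul_mem_GapStart hs (n + 1)
    have := (H.2 _ hn _ hn' (by nlinarith) (n' - n)).1 ?_
    · ext j
      have hj := j.2
      have := this (h.1 s + j + r * n) (by rw [h.apply_add_mul]; omega)
        (by rw [h.apply_add_mul, mul_add]; omega)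
      simp only [Y]
      rw [← this]
      congr 1
      ring
    · intro i h1 h2
      rw [mul_add] at h2
      have := congrFun heq ⟨(i - s - r * n).toNat, by omega⟩
      simp only [X] at this
      rw [Int.toNat_of_nonneg (by omega)] at this
      convert this.symm using 2 <;> ring
  refine ⟨fun B => if hB : ∃ n, X n = B then Y hB.choose else B, h.1 s, ?_⟩
  ext i
  have hX : ∃ n, X n = fun j : Fin r => x (s + j + r * (i / r)) := ⟨i / r, rfl⟩
  simp only [blockRecode]
  rw [dif_pos hX, key _ (i / r) hX.choose_spec]
  simp only [Y, shiftBy]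
  rw [Int.toNat_of_nonneg (Int.emod_nonneg i hr'.ne')]
  congr 1
  conv_lhs => rw [← Int.emod_add_mul_ediv i r]
  ring

end Sequences

section Scale

variable {A : Type}

lemma rdot_pos (x : ℤ → A) (t : ℕ) : 0 < rdot A x t :=
  Finset.prod_pos fun i _ => pow_pos (Nat.prime_nth_prime i).pos _

lemma IsEssentialPeriod.dvd_rdot {x : ℤ → A} {e t : ℕ} (he : IsEssentialPeriod A x e)
    (ht : e ≤ t) : e ∣ rdot A x t := by
  rw [Nat.dvd_iff_prime_pow_dvd_dvd]
  intro p k hp hk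
  rcases Nat.eq_zero_or_pos k with rfl | hkpos
  · simp
  have hpk : p ^ k ≤ e := Nat.le_of_dvd he.1 hk
  have hpe : p ≤ e := (Nat.le_self_pow hkpos.ne' p).trans hpk
  have hke : k ≤ e := (Nat.lt_pow_self hp.one_lt).le.trans hpk
  classical
  have hnth : Nat.nth Nat.Prime (Nat.count Nat.Prime p) = p := Nat.nth_count hp
  have hcount : Nat.count Nat.Prime p ≤ p := Nat.count_le _
  refine dvd_trans ?_ (Finset.dvd_prod_of_mem _
    (Finset.mem_range.2 (show Nat.count Nat.Prime p < t + 1 by omega)))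
  rw [hnth]
  refine pow_dvd_pow p (le_csSup ⟨t + 1, fun j hj => hj.1⟩ ⟨by omega, e, he, hk⟩)

lemma IsToeplitzSeq.exists_essential_mem {x : ℤ → A} (hx : IsToeplitzSeq A x) (i : ℤ) :
    ∃ e, IsEssentialPeriod A x e ∧ i ∈ Per A e x := by
  obtain ⟨p, hp, h⟩ := hx.exists_period {i}
  have hi := h i (Finset.mem_singleton_self i)
  obtain ⟨e, he, heq⟩ := exists_isEssentialPeriod hp ⟨i, hi⟩
  exact ⟨e, he, heq ▸ hi⟩

lemma IsToeplitzSeq.exists_notMem_Per {x : ℤ → A} (hx : IsToeplitzSeq A x) {r : ℕ} (hr : 0 < r) :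
    ∃ i, i ∉ Per A r x := by
  by_contra! h
  exact hx.1 ⟨r, hr, fun i => by simpa using h i 1⟩

lemma IsToeplitzSeq.exists_le_rdot {x : ℤ → A} (hx : IsToeplitzSeq A x) (M : ℕ) :
    ∃ T, ∀ t, T ≤ t → M ≤ rdot A x t := by
  by_cases h : ∃ e, IsEssentialPeriod A x e ∧ M ≤ e
  · obtain ⟨e, he, hM⟩ := h
    exact ⟨e, fun t ht => hM.trans (Nat.le_of_dvd (rdot_pos x t) (he.dvd_rdot ht))⟩
  · push Not at h
    obtain ⟨i, hi⟩ := hx.exists_notMem_Per (Nat.factorial_pos M)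
    obtain ⟨e, he, hmem⟩ := hx.exists_essential_mem i
    exact absurd (Per_subset_of_dvd (Nat.dvd_factorial he.1 (h e he).le) x hmem) hi

lemma IsToeplitzSeq.exists_GapStart_nonempty {x : ℤ → A} (hx : IsToeplitzSeq A x) :
    ∃ T, ∀ t, T ≤ t → (GapStart (rdot A x t) x).Nonempty := by
  obtain ⟨e, he, hmem⟩ := hx.exists_essential_mem 0
  refine ⟨e, fun t ht => ?_⟩
  obtain ⟨j, hj⟩ := hx.exists_notMem_Per (rdot_pos x t)
  exact exists_mem_GapStart (rdot_pos x t) (Per_subset_of_dvd (he.dvd_rdot ht) x hmem) hj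

/-- The runs of the skeletons of `x` along the approximations of its scale get arbitrarily
long. -/
def Growing (x : ℤ → A) : Prop :=
  ∀ L : ℕ, ∃ T, ∀ t, T ≤ t → LongBlocks L (rdot A x t) x

lemma IsToeplitzSeq.hasGrowingBlocks_iff {x : ℤ → A} (hx : IsToeplitzSeq A x) :
    HasGrowingBlocks A x (natFactorization A x) ↔ Growing x := by
  classical
  constructor
  · intro H L
    obtain ⟨I, hI⟩ := H L
    obtain ⟨T, hT⟩ := hx.exists_le_rdot (2 + ∑ i ∈ Finset.range I, natFactorization A x i)
    refine ⟨T, fun t ht s hs i hi1 hi2 => ?_⟩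
    by_contra hcon
    have hbig := hT t ht
    have hmem : rdot A x t ≠ 1 ∧ ∃ t', rdot A x t' = rdot A x t := ⟨by omega, t, rfl⟩
    have hnth := Nat.nth_count (p := fun m => m ≠ 1 ∧ ∃ t, rdot A x t = m) hmem
    set j := Nat.count (fun m => m ≠ 1 ∧ ∃ t, rdot A x t = m) (rdot A x t)
    have hj : natFactorization A x j = rdot A x t := hnth
    have hIj : I ≤ j := by
      by_contra hlt
      have := Finset.single_le_sum (f := natFactorization A x) (s := Finset.range I)
        (fun _ _ => Nat.zero_le _) (Finset.mem_range.2 (not_le.1 hlt))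
      omega
    obtain ⟨c, ⟨hc1, hc2⟩, hmax⟩ := Int.exists_greatest_of_bdd
      (P := fun c => c < s ∧ c ∉ Per A (rdot A x t) x) ⟨s, fun c hc => hc.1.le⟩ ⟨i, hi2, hcon⟩
    have hcs : c ≠ s - 1 := fun h => hc2 (h ▸ hs.1)
    have hic := hmax i ⟨hi2, hcon⟩
    have := hI j hIj (c + 1) (s - 1) (by omega) (fun k h1 h2 => ?_)
      (by rwa [hj, add_sub_cancel_right]) (by rw [hj, sub_add_cancel]; exact hs.2)
    · omega
    · rw [hj]
      by_contra hk
      have := hmax k ⟨by omega, hk⟩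
      omega
  · intro H N
    obtain ⟨T, hT⟩ := H N.toNat
    have hinf : (Set.ofPred fun m => m ≠ 1 ∧ ∃ t, rdot A x t = m).Infinite := by
      refine Set.infinite_of_forall_exists_gt fun M => ?_
      obtain ⟨T, hT⟩ := hx.exists_le_rdot (M + 2)
      have := hT T le_rfl
      exact ⟨rdot A x T, ⟨by omega, T, rfl⟩, by omega⟩
    refine ⟨∑ t ∈ Finset.range T, rdot A x t + 1, fun i hi a b hab hper ha hb => ?_⟩
    obtain ⟨-, t, ht⟩ := Nat.nth_mem_of_infinite hinf i
    change rdot A x t = natFactorization A x i at ht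
    have hle : i ≤ natFactorization A x i := (Nat.nth_strictMono hinf).le_apply
    have hTt : T ≤ t := by
      by_contra hlt
      have := Finset.single_le_sum (f := rdot A x) (s := Finset.range T)
        (fun _ _ => Nat.zero_le _) (Finset.mem_range.2 (not_le.1 hlt))
      omega
    rw [← ht] at hper ha hb
    by_contra hlen
    refine ha (hT t hTt (b + 1) ⟨?_, hb⟩ (a - 1) (by omega) (by omega))
    rw [add_sub_cancel_right]
    exact hper b hab le_rfl

end Scale

section Orbits

variable {A : Type} [TopologicalSpace A]

lemma continuous_shiftBy (k : ℤ) : Continuous (shiftBy k : (ℤ → A) → ℤ → A) :=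
  continuous_pi fun i => continuous_apply (i + k)

lemma orbitClosure_eq (x : ℤ → A) :
    orbitClosure A x = closure (range fun n : ℕ => shiftBy (n : ℤ) x) := by
  simp only [orbitClosure, shiftMap_iterate]
  congr 1
  ext y
  simp [eq_comm]

lemma self_mem_orbitClosure (x : ℤ → A) : x ∈ orbitClosure A x :=
  subset_closure ⟨0, rfl⟩

lemma exists_mem_closure_residue {X : Type*} [TopologicalSpace X] (f : ℕ → X) {p : ℕ}
    (hp : 0 < p) {x : X} (hx : x ∈ closure (range f)) :
    ∃ c, x ∈ closure (range fun n => f (c + n * p)) := by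
  have h : range f ⊆ ⋃ c ∈ Finset.range p, range fun n => f (c + n * p) := by
    rintro _ ⟨n, rfl⟩
    simp only [mem_iUnion]
    exact ⟨n % p, Finset.mem_range.2 (Nat.mod_lt n hp), n / p, by
      simp only [mul_comm, Nat.mod_add_div]⟩
  have := closure_mono h hx
  rw [Finset.closure_biUnion] at this
  simp only [mem_iUnion] at this
  obtain ⟨c, -, hc⟩ := this
  exact ⟨c, hc⟩

/-- The closure of the forward orbit of `x` under the `r`-th power of the shift. -/
def stepClosure (r : ℕ) (x : ℤ → A) : Set (ℤ → A) :=
  closure (range fun n : ℕ => shiftBy (n * r : ℤ) x)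

lemma exists_mem_stepClosure {r : ℕ} (hr : 0 < r) {x y : ℤ → A} (hy : y ∈ orbitClosure A x) :
    ∃ k : ℕ, y ∈ stepClosure r (shiftBy k x) := by
  rw [orbitClosure_eq] at hy
  obtain ⟨c, hc⟩ := exists_mem_closure_residue _ hr hy
  refine ⟨c, ?_⟩
  have : (fun n : ℕ => shiftBy (n * r : ℤ) (shiftBy c x)) =
      fun n => shiftBy ((c + n * r : ℕ) : ℤ) x := by
    funext n
    rw [shiftBy_shiftBy]
    push_cast
    rw [add_comm]
  rwa [stepClosure, this]

lemma stepClosure_subset_of_dvd {p r : ℕ} (h : p ∣ r) (x : ℤ → A) :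
    stepClosure r x ⊆ stepClosure p x := by
  obtain ⟨c, rfl⟩ := h
  refine closure_mono ?_
  rintro _ ⟨n, rfl⟩
  exact ⟨n * c, by push_cast; congr 1; ring⟩

lemma shiftBy_mem_orbitClosure {x y : ℤ → A} (hy : y ∈ orbitClosure A x) (n : ℕ) :
    shiftBy n y ∈ orbitClosure A x := by
  rw [orbitClosure_eq] at hy ⊢
  refine map_mem_closure (continuous_shiftBy n) hy ?_
  rintro _ ⟨k, rfl⟩
  exact ⟨n + k, by rw [shiftBy_shiftBy]; push_cast; rfl⟩

lemma orbitClosure_subset {x y : ℤ → A} (hy : y ∈ orbitClosure A x) :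
    orbitClosure A y ⊆ orbitClosure A x := by
  rw [orbitClosure_eq y]
  refine closure_minimal ?_ isClosed_closure
  rintro _ ⟨n, rfl⟩
  exact shiftBy_mem_orbitClosure hy n

variable [DiscreteTopology A]

lemma isOpen_cylinder (s : Finset ℤ) (y : ℤ → A) : IsOpen {z : ℤ → A | ∀ i ∈ s, z i = y i} := by
  have : {z : ℤ → A | ∀ i ∈ s, z i = y i} = (s : Set ℤ).pi fun i => {y i} := by
    ext z; simp [Set.mem_pi]
  rw [this]
  exact isOpen_set_pi s.finite_toSet fun i _ => isOpen_discrete _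

lemma mem_closure_iff_forall_finset {S : Set (ℤ → A)} {y : ℤ → A} :
    y ∈ closure S ↔ ∀ s : Finset ℤ, ∃ z ∈ S, ∀ i ∈ s, z i = y i := by
  rw [mem_closure_iff]
  constructor
  · intro h s
    obtain ⟨z, hz, hzS⟩ := h _ (isOpen_cylinder s y) fun _ _ => rfl
    exact ⟨z, hzS, hz⟩
  · intro h o ho hy
    obtain ⟨s, u, hu, hsub⟩ := isOpen_pi_iff.1 ho y hy
    obtain ⟨z, hzS, hz⟩ := h s
    exact ⟨z, hsub fun i hi => (hz i hi).symm ▸ (hu i hi).2, hzS⟩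

lemma Per_subset_of_mem_stepClosure {r : ℕ} {z y : ℤ → A} (hy : y ∈ stepClosure r z) :
    Per A r z ⊆ Per A r y := by
  intro i hi k
  obtain ⟨_, ⟨n, rfl⟩, hn⟩ := mem_closure_iff_forall_finset.1 hy {i + r * k, i}
  rw [← hn (i + r * k) (by simp), ← hn i (by simp)]
  have h1 := hi (k + n)
  have h2 := hi n
  simp only [shiftBy]
  rw [show i + (r : ℤ) * k + n * r = i + r * (k + n) by ring, mul_comm (n : ℤ), h1, h2]

lemma IsToeplitzSeq.Per_eq_of_mem_stepClosure {r : ℕ} {z y : ℤ → A}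
    (hz : IsToeplitzSeq A z) (hy : y ∈ stepClosure r z) : Per A r y = Per A r z := by
  refine (Per_subset_of_mem_stepClosure hy).antisymm' fun i hi => ?_
  by_contra hcon
  simp only [Per, Set.mem_ofPred_eq, not_forall] at hcon
  obtain ⟨j, hj⟩ := hcon
  obtain ⟨p, hp, hper⟩ := hz.exists_period {i, i + r * j}
  obtain ⟨c, hc⟩ := exists_mem_closure_residue _ hp hy
  obtain ⟨_, ⟨n, rfl⟩, hn⟩ := mem_closure_iff_forall_finset.1 hc {i - r * c, i + r * j - r * c}
  have h1 := hn (i - r * c) (by simp)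
  have h2 := hn (i + r * j - r * c) (by simp)
  have h3 := hi (-c)
  have h4 := hi (j - c)
  have h5 := hper i (by simp) (n * r)
  have h6 := hper (i + r * j) (by simp) (n * r)
  simp only [shiftBy] at h1 h2
  push_cast at h1 h2
  rw [show i - (r : ℤ) * c + (c + n * p) * r = i + p * (n * r) by ring,
    show i - (r : ℤ) * c = i + r * -c by ring] at h1
  rw [show i + (r : ℤ) * j - r * c + (c + n * p) * r = i + r * j + p * (n * r) by ring,
    show i + (r : ℤ) * j - r * c = i + r * (j - c) by ring] at h2
  exact hj (by rw [← h6, h2, h4, ← h3, ← h1, h5])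

/-- The orbit closures of Toeplitz sequences. -/
def IsToeplitzShift (O : Set (ℤ → A)) : Prop := ∃ w, IsToeplitzSeq A w ∧ O = orbitClosure A w

lemma IsToeplitzSeq.mem_orbitClosure {w x : ℤ → A} (hw : IsToeplitzSeq A w)
    (hx : x ∈ orbitClosure A w) : w ∈ orbitClosure A x := by
  rw [orbitClosure_eq] at hx ⊢
  rw [mem_closure_iff_forall_finset]
  intro s
  classical
  obtain ⟨p, hp, hper⟩ := hw.exists_period s
  obtain ⟨c, hc⟩ := exists_mem_closure_residue _ hp hx
  obtain ⟨N, hN⟩ : ∃ N : ℕ, N + c = c * p := ⟨c * p - c, by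
    have := Nat.le_mul_of_pos_right c hp
    omega⟩
  obtain ⟨_, ⟨n, rfl⟩, hn⟩ := mem_closure_iff_forall_finset.1 hc (s.image (· + (N : ℤ)))
  refine ⟨_, ⟨N, rfl⟩, fun i hi => ?_⟩
  have h1 := hn _ (Finset.mem_image_of_mem _ hi)
  simp only [shiftBy] at h1 ⊢
  rw [← h1, ← hper i hi (c + n)]
  congr 1
  have : (N : ℤ) + c = c * p := by exact_mod_cast hN
  push_cast
  linear_combination this

lemma IsToeplitzSeq.shiftBy_mem_orbitClosure {w : ℤ → A} (hw : IsToeplitzSeq A w) (k : ℤ) :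
    shiftBy k w ∈ orbitClosure A w := by
  rw [orbitClosure_eq, mem_closure_iff_forall_finset]
  intro s
  classical
  obtain ⟨p, hp, hper⟩ := hw.exists_period (s.image (· + k))
  have hp' : (1 : ℤ) ≤ p := by exact_mod_cast hp
  obtain ⟨n, hn⟩ : ∃ n : ℕ, (n : ℤ) = k + p * |k| := ⟨(k + p * |k|).toNat,
    Int.toNat_of_nonneg (by nlinarith [neg_abs_le k, abs_nonneg k])⟩
  refine ⟨_, ⟨n, rfl⟩, fun i hi => ?_⟩
  simp only [shiftBy]
  rw [hn, ← add_assoc]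
  exact hper _ (Finset.mem_image_of_mem _ hi) _

namespace IsToeplitzShift

variable {O : Set (ℤ → A)} (hO : IsToeplitzShift O)
include hO

lemma orbitClosure_eq {x : ℤ → A} (hx : x ∈ O) : orbitClosure A x = O := by
  obtain ⟨w, hw, rfl⟩ := hO
  exact (orbitClosure_subset hx).antisymm (orbitClosure_subset (hw.mem_orbitClosure hx))

lemma shiftBy_mem {x : ℤ → A} (hx : x ∈ O) (k : ℤ) : shiftBy k x ∈ O := by
  obtain ⟨w, hw, rfl⟩ := hO
  have : IsClosed (orbitClosure A w) := isClosed_closure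
  rw [← this.closure_eq]
  rw [_root_.orbitClosure_eq] at hx
  refine map_mem_closure (continuous_shiftBy k) hx ?_
  rintro _ ⟨n, rfl⟩
  rw [shiftBy_shiftBy]
  exact hw.shiftBy_mem_orbitClosure _

lemma Per_eq_of_mem_stepClosure {r : ℕ} (hr : 0 < r) {z y : ℤ → A} (hz : z ∈ O)
    (hy : y ∈ stepClosure r z) : Per A r y = Per A r z := by
  have hyO : y ∈ O := by
    rw [← hO.orbitClosure_eq hz, _root_.orbitClosure_eq]
    refine closure_mono ?_ hy
    rintro _ ⟨n, rfl⟩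
    exact ⟨n * r, by push_cast; rfl⟩
  obtain ⟨w, hw, rfl⟩ := hO
  obtain ⟨k, hk⟩ := exists_mem_stepClosure hr hyO
  obtain ⟨l, hl⟩ := exists_mem_stepClosure hr hz
  have hk' := (hw.shift k).Per_eq_of_mem_stepClosure hk
  have hl' := (hw.shift l).Per_eq_of_mem_stepClosure hl
  refine (Per_eq_of_subset_of_translate hr (Per_subset_of_mem_stepClosure hy)
    (d := k - l) fun i => ?_).symm
  rw [hk', hl', mem_Per_shiftBy, mem_Per_shiftBy]
  ring_nf

lemma exists_translate {r : ℕ} (hr : 0 < r) {x z : ℤ → A} (hx : x ∈ O) (hz : z ∈ O) :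
    ∃ k : ℕ, x ∈ stepClosure r (shiftBy k z) ∧ Per A r x = Per A r (shiftBy k z) := by
  rw [← hO.orbitClosure_eq hz] at hx
  obtain ⟨k, hk⟩ := exists_mem_stepClosure hr hx
  exact ⟨k, hk, hO.Per_eq_of_mem_stepClosure hr (hO.shiftBy_mem hz k) hk⟩

lemma isEssentialPeriod {x z : ℤ → A} (hx : x ∈ O) (hz : z ∈ O) {e : ℕ}
    (he : IsEssentialPeriod A x e) : IsEssentialPeriod A z e := by
  obtain ⟨k, hk, -⟩ := hO.exists_translate (Nat.factorial_pos e) hx hz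
  have key : ∀ q, 1 ≤ q → q ≤ e → Per A q x = Per A q (shiftBy k z) := fun q h1 h2 =>
    hO.Per_eq_of_mem_stepClosure h1 (hO.shiftBy_mem hz k)
      (stepClosure_subset_of_dvd (Nat.dvd_factorial h1 h2) _ hk)
  obtain ⟨he1, ⟨i, hi⟩, hmin⟩ := he
  rw [key e he1 le_rfl] at hi
  refine ⟨he1, ⟨_, mem_Per_shiftBy.1 hi⟩, fun q h1 h2 heq => hmin q h1 h2 ?_⟩
  rw [key e he1 le_rfl, key q h1 h2.le]
  ext i
  rw [mem_Per_shiftBy, mem_Per_shiftBy, heq]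

lemma rdot_eq {x z : ℤ → A} (hx : x ∈ O) (hz : z ∈ O) (t : ℕ) : rdot A x t = rdot A z t :=
  rdot_congr (fun e he => ⟨e, hO.isEssentialPeriod hx hz he, dvd_rfl⟩)
    (fun e he => ⟨e, hO.isEssentialPeriod hz hx he, dvd_rfl⟩) t

lemma GapStart_nonempty {r : ℕ} (hr : 0 < r) {x z : ℤ → A} (hx : x ∈ O) (hz : z ∈ O)
    (h : (GapStart r x).Nonempty) : (GapStart r z).Nonempty := by
  obtain ⟨k, -, hk⟩ := hO.exists_translate hr hx hz
  rw [GapStart_congr hk] at h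
  obtain ⟨s, hs⟩ := h
  exact ⟨_, mem_GapStart_shiftBy.1 hs⟩

lemma longBlocks {r L : ℕ} (hr : 0 < r) {x z : ℤ → A} (hx : x ∈ O) (hz : z ∈ O)
    (h : LongBlocks L r x) : LongBlocks L r z := by
  obtain ⟨k, -, hk⟩ := hO.exists_translate hr hz hx
  intro s hs i h1 h2
  rw [GapStart_congr hk, mem_GapStart_shiftBy] at hs
  rw [hk, mem_Per_shiftBy]
  exact h _ hs _ (by omega) (by omega)

lemma growing {x z : ℤ → A} (hx : x ∈ O) (hz : z ∈ O) (h : Growing x) : Growing z := by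
  intro L
  obtain ⟨T, hT⟩ := h L
  refine ⟨T, fun t ht => ?_⟩
  rw [← hO.rdot_eq hx hz]
  exact hO.longBlocks (rdot_pos x t) hx hz (hT t ht)

lemma exists_GapStart_nonempty : ∃ T, ∀ t, T ≤ t → ∀ x ∈ O,
    (GapStart (rdot A x t) x).Nonempty := by
  obtain ⟨w, hw, hOw⟩ := id hO
  have hwO : w ∈ O := hOw ▸ self_mem_orbitClosure w
  obtain ⟨T, hT⟩ := hw.exists_GapStart_nonempty
  refine ⟨T, fun t ht x hx => ?_⟩
  rw [hO.rdot_eq hx hwO]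
  exact hO.GapStart_nonempty (rdot_pos w t) hwO hx (hT t ht)

end IsToeplitzShift

end Orbits

section Codes

variable {A : Type}

/-- Sliding block codes, given by a radius and a local rule. -/
def Code (A : Type) : Type := Σ m : ℕ, ((Finset.Icc (-(m : ℤ)) m → A) → A)

instance [Finite A] : Countable (Code A) :=
  inferInstanceAs (Countable (Σ m : ℕ, ((Finset.Icc (-(m : ℤ)) m → A) → A)))

/-- The action of a sliding block code. -/
def Code.map (c : Code A) (x : ℤ → A) : ℤ → A := fun i => c.2 fun j => x (i + j)

lemma Tracks.mono {m n : ℕ} {x y : ℤ → A} (h : Tracks m x y) (hmn : m ≤ n) : Tracks n x y :=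
  fun i k H => h i k fun j h1 h2 => H j (by omega) (by omega)

lemma Code.tracks (c : Code A) (x : ℤ → A) : Tracks c.1 x (c.map x) := by
  intro i k H
  refine congrArg c.2 (funext fun ⟨j, hj⟩ => ?_)
  rw [Finset.mem_Icc] at hj
  change x (i + k + j) = x (i + j)
  rw [add_right_comm]
  exact H _ (by omega) (by omega)

lemma Code.map_shiftBy (c : Code A) (k : ℤ) (x : ℤ → A) :
    c.map (shiftBy k x) = shiftBy k (c.map x) := by
  ext i
  simp only [Code.map, shiftBy, add_right_comm]

variable [TopologicalSpace A] [DiscreteTopology A]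

lemma Code.continuous (c : Code A) : Continuous c.map :=
  continuous_pi fun i => (continuous_of_discreteTopology (f := c.2)).comp
    (continuous_pi fun j => continuous_apply (i + j))

lemma exists_code {O : Set (ℤ → A)} (hO : IsCompact O) (hs : ∀ x ∈ O, ∀ k, shiftBy k x ∈ O)
    (f : O → ℤ → A) (hf : Continuous f)
    (hequi : ∀ (x : O) (k : ℤ), f ⟨shiftBy k x, hs x x.2 k⟩ = shiftBy k (f x)) :
    ∃ c : Code A, ∀ x : O, f x = c.map x := by
  classical
  have : CompactSpace O := isCompact_iff_compactSpace.1 hO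
  have hloc : ∀ x : O, ∃ s : Finset ℤ, ∀ y : O, (∀ i ∈ s, (y : ℤ → A) i = x.1 i) →
      f y 0 = f x 0 := by
    intro x
    have ho : IsOpen {y : O | f y 0 = f x 0} :=
      (isOpen_discrete {f x 0}).preimage ((continuous_apply 0).comp hf)
    obtain ⟨V, hV, hVeq⟩ := isOpen_induced_iff.1 ho
    have hxV : (x : ℤ → A) ∈ V := by
      have : x ∈ (Subtype.val ⁻¹' V : Set O) := hVeq ▸ rfl
      exact this
    obtain ⟨s, u, hu, hsub⟩ := isOpen_pi_iff.1 hV x hxV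
    refine ⟨s, fun y hy => ?_⟩
    have : y ∈ (Subtype.val ⁻¹' V : Set O) :=
      hsub fun i hi => (hy i hi).symm ▸ (hu i hi).2
    rw [hVeq] at this
    exact this
  choose s hs' using hloc
  obtain ⟨t, ht⟩ := CompactSpace.elim_nhds_subcover
    (fun x : O => {y : O | ∀ i ∈ s x, (y : ℤ → A) i = x.1 i})
    fun x => ((isOpen_cylinder (s x) x.1).preimage continuous_subtype_val).mem_nhds fun _ _ => rfl
  obtain ⟨m, hm⟩ : ∃ m : ℕ, ∀ x ∈ t, ∀ i ∈ s x, i ∈ Finset.Icc (-(m : ℤ)) m := by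
    refine ⟨∑ x ∈ t, ∑ i ∈ s x, i.natAbs, fun x hx i hi => ?_⟩
    have h1 := Finset.single_le_sum (f := fun i : ℤ => i.natAbs) (fun _ _ => Nat.zero_le _) hi
    have h2 := Finset.single_le_sum (f := fun x => ∑ i ∈ s x, i.natAbs)
      (fun _ _ => Nat.zero_le _) hx
    rw [Finset.mem_Icc]
    omega
  have key : ∀ y y' : O, (∀ j ∈ Finset.Icc (-(m : ℤ)) m, y.1 j = y'.1 j) → f y 0 = f y' 0 := by
    intro y y' h
    have : y ∈ ⋃ x ∈ t, {y : O | ∀ i ∈ s x, (y : ℤ → A) i = x.1 i} := ht ▸ Set.mem_univ y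
    simp only [mem_iUnion] at this
    obtain ⟨x, hx, hyx⟩ := this
    rw [hs' x y hyx, hs' x y' fun i hi => (h i (hm x hx i hi)).symm.trans (hyx i hi)]
  refine ⟨⟨m, fun B => if h : ∃ x : O, ∀ j : Finset.Icc (-(m : ℤ)) m, x.1 j = B j
    then f h.choose 0 else B ⟨0, Finset.mem_Icc.2 ⟨by omega, by omega⟩⟩⟩, fun x => ?_⟩
  ext i
  have hex : ∃ y : O, ∀ j : Finset.Icc (-(m : ℤ)) m, y.1 j = x.1 (i + j) :=
    ⟨⟨shiftBy i x, hs x x.2 i⟩, fun j => congrArg x.1 (add_comm _ _)⟩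
  simp only [Code.map]
  rw [dif_pos hex]
  have h1 := congrFun (hequi x i) 0
  simp only [shiftBy, zero_add] at h1
  rw [← h1]
  refine key _ _ fun j hj => ?_
  rw [hex.choose_spec ⟨j, hj⟩]
  exact congrArg x.1 (add_comm _ _)

lemma Code.exists_comp [Finite A] (c d : Code A) :
    ∃ e : Code A, ∀ x, e.map x = d.map (c.map x) := by
  obtain ⟨e, he⟩ := exists_code (O := (univ : Set (ℤ → A))) isCompact_univ
    (fun _ _ _ => Set.mem_univ _) (fun x => d.map (c.map x))
    (d.continuous.comp (c.continuous.comp continuous_subtype_val))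
    (fun x k => by rw [c.map_shiftBy, d.map_shiftBy])
  exact ⟨e, fun x => (he ⟨x, Set.mem_univ x⟩).symm⟩

/-- The codes `c` and `d` induce mutually inverse bijections between `O` and `O'`. -/
def CodeConj (c d : Code A) (O O' : Set (ℤ → A)) : Prop :=
  (∀ x ∈ O, c.map x ∈ O' ∧ d.map (c.map x) = x) ∧ ∀ y ∈ O', d.map y ∈ O ∧ c.map (d.map y) = y

omit [TopologicalSpace A] [DiscreteTopology A] in
lemma CodeConj.symm {c d : Code A} {O O' : Set (ℤ → A)} (h : CodeConj c d O O') :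
    CodeConj d c O' O := ⟨h.2, h.1⟩

lemma isTopConj_iff {O O' : Set (ℤ → A)} (hO : IsCompact O) (hO' : IsCompact O')
    (hs : ∀ x ∈ O, ∀ k, shiftBy k x ∈ O) (hs' : ∀ x ∈ O', ∀ k, shiftBy k x ∈ O') :
    IsTopConj A O O' ↔ ∃ c d, CodeConj c d O O' := by
  constructor
  · rintro ⟨e, he⟩
    have hnat : ∀ (n : ℕ) (x : O), (e ⟨shiftBy n x, hs x x.2 n⟩).1 = shiftBy n (e x).1 := by
      intro n x
      induction n with
      | zero =>
        have : (⟨shiftBy (0 : ℕ) x, hs x x.2 (0 : ℕ)⟩ : O) = x := by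
          ext i; simp [shiftBy]
        rw [this]
        ext i; simp [shiftBy]
      | succ n ih =>
        rw [he ⟨shiftBy n x, hs x x.2 n⟩ _ (by
          rw [shiftMap_eq_shiftBy, shiftBy_shiftBy]; push_cast; rw [add_comm]), ih,
          shiftMap_eq_shiftBy, shiftBy_shiftBy]
        push_cast
        rw [add_comm]
    have hint : ∀ (x : O) (k : ℤ), (e ⟨shiftBy k x, hs x x.2 k⟩).1 = shiftBy k (e x).1 := by
      intro x k
      obtain ⟨n, rfl | rfl⟩ := k.eq_nat_or_neg
      · exact hnat n x
      · have h := hnat n ⟨shiftBy (-n) x, hs x x.2 _⟩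
        have hx : (⟨shiftBy n (shiftBy (-n) x.1), hs _ (hs x x.2 _) n⟩ : O) = x := by
          ext i; simp [shiftBy]
        rw [hx] at h
        rw [h, shiftBy_shiftBy]
        ext i; simp [shiftBy]
    have hint' : ∀ (y : O') (k : ℤ),
        (e.symm ⟨shiftBy k y, hs' y y.2 k⟩).1 = shiftBy k (e.symm y).1 := by
      intro y k
      have h := hint (e.symm y) k
      rw [e.apply_symm_apply] at h
      have : (⟨shiftBy k y, hs' y y.2 k⟩ : O') =
          e ⟨shiftBy k (e.symm y), hs _ (e.symm y).2 k⟩ := Subtype.ext h.symm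
      rw [this, e.symm_apply_apply]
    obtain ⟨c, hc⟩ := exists_code hO hs (fun x => (e x).1)
      (continuous_subtype_val.comp e.continuous) hint
    obtain ⟨d, hd⟩ := exists_code hO' hs' (fun x => (e.symm x).1)
      (continuous_subtype_val.comp e.symm.continuous) hint'
    refine ⟨c, d, fun x hx => ?_, fun y hy => ?_⟩
    · rw [← hc ⟨x, hx⟩, ← hd, e.symm_apply_apply]
      exact ⟨(e _).2, rfl⟩
    · rw [← hd ⟨y, hy⟩, ← hc, e.apply_symm_apply]
      exact ⟨(e.symm _).2, rfl⟩
  · rintro ⟨c, d, h⟩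
    refine ⟨⟨⟨fun x => ⟨c.map x, (h.1 x x.2).1⟩, fun y => ⟨d.map y, (h.2 y y.2).1⟩,
      fun x => Subtype.ext (h.1 x x.2).2, fun y => Subtype.ext (h.2 y y.2).2⟩,
      (c.continuous.comp continuous_subtype_val).subtype_mk _,
      (d.continuous.comp continuous_subtype_val).subtype_mk _⟩, fun x y hxy => ?_⟩
    change c.map y = shiftBy 1 (c.map x)
    rw [hxy, shiftMap_eq_shiftBy, c.map_shiftBy]

end Codes

section Levels

variable {A : Type} [TopologicalSpace A] [DiscreteTopology A]

/-- Sequences with gaps whose block structures with respect to `r` determine each other. -/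
def Comparable (r : ℕ) (x y : ℤ → A) : Prop :=
  (GapStart r x).Nonempty ∧ BlockConj r x y ∧ BlockConj r y x

omit [TopologicalSpace A] [DiscreteTopology A] in
lemma Comparable.symm {r : ℕ} {x y : ℤ → A} (h : Comparable r x y) : Comparable r y x := by
  obtain ⟨⟨s, hs⟩, ⟨g, hg⟩, h2⟩ := h
  exact ⟨⟨_, hg.1 s hs⟩, h2, g, hg⟩

omit [TopologicalSpace A] [DiscreteTopology A] in
lemma Comparable.trans {r : ℕ} {x y z : ℤ → A} (h : Comparable r x y) (h' : Comparable r y z) :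
    Comparable r x z :=
  ⟨h.1, h.2.1.trans h'.2.1, h'.2.2.trans h.2.2⟩

omit [TopologicalSpace A] [DiscreteTopology A] in
lemma BlockMap.congr_on {r : ℕ} {h : ℤ → ℤ} {x y : ℤ → A}
    (H : ∀ s : Finset ℤ, ∃ z z', BlockMap r h z z' ∧ Per A r x = Per A r z ∧
      Per A r y = Per A r z' ∧ (∀ i ∈ s, z i = x i) ∧ ∀ i ∈ s, z' i = y i) :
    BlockMap r h x y := by
  classical
  obtain ⟨z, z', hz, hx, hy, -⟩ := H ∅
  refine ⟨fun s hs => ?_, fun s hs s' hs' hlt n => ?_⟩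
  · rw [GapStart_congr hx] at hs
    rw [GapStart_congr hy]
    exact hz.1 s hs
  · clear hz hx hy
    obtain ⟨z, z', hz, hx, hy, h1, h2⟩ := H
      ((Finset.Ico s s' ∪ Finset.Ico (h s) (h s')) ∪
        (Finset.Ico s s' ∪ Finset.Ico (h s) (h s')).image (· + (r : ℤ) * n))
    rw [GapStart_congr hx] at hs hs'
    have key := hz.2 s hs s' hs' hlt n
    have e1 : ∀ i, s ≤ i → i < s' → (z i = x i ∧ z (i + r * n) = x (i + r * n)) := fun i hi hi' =>
      ⟨h1 i (by simp; omega), h1 _ (Finset.mem_union_right _ (Finset.mem_image_of_mem _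
        (by simp; omega)))⟩
    have e2 : ∀ i, h s ≤ i → i < h s' → (z' i = y i ∧ z' (i + r * n) = y (i + r * n)) :=
      fun i hi hi' => ⟨h2 i (by simp; omega), h2 _ (Finset.mem_union_right _
        (Finset.mem_image_of_mem _ (by simp; omega)))⟩
    constructor
    · intro hrep i hi hi'
      rw [← (e2 i hi hi').1, ← (e2 i hi hi').2]
      refine key.1 (fun j hj hj' => ?_) i hi hi'
      rw [(e1 j hj hj').1, (e1 j hj hj').2]
      exact hrep j hj hj'
    · intro hrep i hi hi'
      rw [← (e1 i hi hi').1, ← (e1 i hi hi').2]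
      refine key.2 (fun j hj hj' => ?_) i hi hi'
      rw [(e2 j hj hj').1, (e2 j hj hj').2]
      exact hrep j hj hj'

omit [TopologicalSpace A] [DiscreteTopology A] in
lemma Per_shiftBy_mul (r : ℕ) (n : ℤ) (x : ℤ → A) : Per A r (shiftBy (n * r) x) = Per A r x := by
  ext i
  rw [mem_Per_shiftBy, mul_comm, add_mul_mem_Per_iff]

omit [TopologicalSpace A] [DiscreteTopology A] in
lemma BlockConj.shift {r : ℕ} {x y : ℤ → A} (H : BlockConj r x y) (k : ℤ) :
    BlockConj r (shiftBy k x) (shiftBy k y) := by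
  obtain ⟨h, H⟩ := H
  exact ⟨⟨fun i => h.1 (i + k) - k, fun i => by
    change h.1 (i + r + k) - k = h.1 (i + k) - k + r
    rw [add_right_comm, h.2]
    ring⟩, H.shift k⟩

omit [TopologicalSpace A] [DiscreteTopology A] in
lemma BlockConj.of_limit {r : ℕ} {x y z z' : ℤ → A} (H : BlockConj r z z')
    (hx : Per A r x = Per A r z) (hy : Per A r y = Per A r z')
    (hlim : ∀ s : Finset ℤ, ∃ n : ℤ, (∀ i ∈ s, shiftBy (n * r) z i = x i) ∧
      ∀ i ∈ s, shiftBy (n * r) z' i = y i) : BlockConj r x y := by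
  obtain ⟨h, H⟩ := H
  refine ⟨h, BlockMap.congr_on fun s => ?_⟩
  obtain ⟨n, h1, h2⟩ := hlim s
  refine ⟨_, _, ?_, ?_, ?_, h1, h2⟩
  · have := H.shift (n * r)
    have he : (fun i => h.1 (i + n * r) - n * r) = h.1 := by
      funext i
      rw [mul_comm, h.apply_add_mul, add_sub_cancel_right]
    rwa [he] at this
  · rw [hx, Per_shiftBy_mul]
  · rw [hy, Per_shiftBy_mul]

namespace CodeConj

variable {c d : Code A} {O O' : Set (ℤ → A)}

lemma comparable (h : CodeConj c d O O') (hO : IsToeplitzShift O) (hO' : IsToeplitzShift O')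
    {r : ℕ} (hr : 0 < r) {x x₀ : ℤ → A} (hx : x ∈ O) (hx₀ : x₀ ∈ O)
    (H : Comparable r x₀ (c.map x₀)) : Comparable r x (c.map x) := by
  classical
  obtain ⟨k, hk, hper⟩ := hO.exists_translate hr hx hx₀
  have hzO := hO.shiftBy_mem hx₀ k
  have hlim : ∀ s : Finset ℤ, ∃ n : ℤ, (∀ i ∈ s, shiftBy (n * r) (shiftBy k x₀) i = x i) ∧
      ∀ i ∈ s, shiftBy (n * r) (shiftBy k (c.map x₀)) i = c.map x i := by
    intro s
    obtain ⟨_, ⟨h1, h2⟩, n, rfl⟩ := mem_closure_iff.1 hk _ ((isOpen_cylinder s x).inter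
      ((isOpen_cylinder s (c.map x)).preimage c.continuous)) ⟨fun _ _ => rfl, fun _ _ => rfl⟩
    refine ⟨n, h1, fun i hi => ?_⟩
    rw [← c.map_shiftBy, ← c.map_shiftBy]
    exact h2 i hi
  have hper' : Per A r (c.map x) = Per A r (shiftBy k (c.map x₀)) := by
    rw [← c.map_shiftBy]
    refine hO'.Per_eq_of_mem_stepClosure hr (h.1 _ hzO).1 ?_
    refine map_mem_closure c.continuous hk ?_
    rintro _ ⟨n, rfl⟩
    exact ⟨n, (c.map_shiftBy _ _).symm⟩
  refine ⟨hO.GapStart_nonempty hr hx₀ hx H.1, (H.2.1.shift k).of_limit hper hper' hlim,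
    (H.2.2.shift k).of_limit hper' hper fun s => ?_⟩
  obtain ⟨n, h1, h2⟩ := hlim s
  exact ⟨n, h2, h1⟩

lemma exists_essential_dvd (h : CodeConj c d O O') (hO : IsToeplitzShift O)
    (hO' : IsToeplitzShift O') {x y : ℤ → A} (hx : x ∈ O) (hy : y ∈ O') {e : ℕ}
    (he : IsEssentialPeriod A x e) : ∃ e', IsEssentialPeriod A y e' ∧ e ∣ e' := by
  obtain ⟨w, hw, hwO⟩ := id hO'
  have hwO' : w ∈ O' := hwO ▸ self_mem_orbitClosure w
  obtain ⟨e', he', hdvd⟩ := (d.tracks w).exists_essential_dvd hw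
    (hO.isEssentialPeriod hx (h.2 w hwO').1 he)
  exact ⟨e', hO'.isEssentialPeriod hwO' hy he', hdvd⟩

lemma rdot_eq (h : CodeConj c d O O') (hO : IsToeplitzShift O)
    (hO' : IsToeplitzShift O') {x y : ℤ → A} (hx : x ∈ O) (hy : y ∈ O') (t : ℕ) :
    rdot A x t = rdot A y t :=
  rdot_congr (fun _ he => h.exists_essential_dvd hO hO' hx hy he)
    (fun _ he => h.symm.exists_essential_dvd hO' hO hy hx he) t

lemma exists_comparable (h : CodeConj c d O O') (hO : IsToeplitzShift O)
    (hO' : IsToeplitzShift O') (hgO : ∀ x ∈ O, Growing x) (hgO' : ∀ x ∈ O', Growing x) :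
    ∃ n, ∀ t, n ≤ t → ∀ x ∈ O, Comparable (rdot A x t) x (c.map x) := by
  obtain ⟨w, hw, hwO⟩ := id hO
  have hwO' : w ∈ O := hwO ▸ self_mem_orbitClosure w
  obtain ⟨T, hT⟩ := hO.exists_GapStart_nonempty
  obtain ⟨T₁, hT₁⟩ := hgO w hwO' (2 * (c.1 + d.1) + 1)
  obtain ⟨T₂, hT₂⟩ := hgO' (c.map w) (h.1 w hwO').1 (2 * (c.1 + d.1) + 1)
  refine ⟨T + T₁ + T₂, fun t ht x hx => ?_⟩
  rw [hO.rdot_eq hx hwO' t]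
  refine h.comparable hO hO' (rdot_pos _ _) hx hwO' ?_
  have h1 := (c.tracks w).mono (Nat.le_add_right c.1 d.1)
  have h2 := (d.tracks (c.map w)).mono (Nat.le_add_left d.1 c.1)
  rw [(h.1 w hwO').2] at h2
  have l1 := hT₁ t (by omega)
  have l2 := hT₂ t (by omega)
  rw [← h.rdot_eq hO hO' hwO' (h.1 w hwO').1] at l2
  exact ⟨hT t (by omega) w hwO', h1.blockConj h2 l1 l2, h2.blockConj h1 l2 l1⟩

end CodeConj

/-- The `n`-th approximation of the conjugacy relation: either equality, or conjugacy by a block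
code which is compatible with the block structure from the `n`-th stage of the scale on. -/
def Level (n : ℕ) (O O' : Set (ℤ → A)) : Prop :=
  O = O' ∨ ∃ c d, CodeConj c d O O' ∧
    ∀ t, n ≤ t → ∀ x ∈ O, Comparable (rdot A x t) x (c.map x)

omit [TopologicalSpace A] [DiscreteTopology A] in
lemma Level.succ {n : ℕ} {O O' : Set (ℤ → A)} (h : Level n O O') : Level (n + 1) O O' :=
  h.imp_right fun ⟨c, d, h1, h2⟩ => ⟨c, d, h1, fun t ht => h2 t (Nat.le_of_succ_le ht)⟩

lemma Level.symm {n : ℕ} {O O' : Set (ℤ → A)} (hO : IsToeplitzShift O)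
    (hO' : IsToeplitzShift O') (h : Level n O O') : Level n O' O := by
  rcases h with rfl | ⟨c, d, h, H⟩
  · exact Or.inl rfl
  refine Or.inr ⟨d, c, h.symm, fun t ht y hy => ?_⟩
  have := H t ht _ (h.2 y hy).1
  rw [(h.2 y hy).2, h.rdot_eq hO hO' (h.2 y hy).1 hy] at this
  exact this.symm

lemma Level.trans [Finite A] {n : ℕ} {O O' O'' : Set (ℤ → A)} (hO : IsToeplitzShift O)
    (hO' : IsToeplitzShift O') (h : Level n O O') (h' : Level n O' O'') : Level n O O'' := by
  rcases h with rfl | ⟨c, d, h, H⟩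
  · exact h'
  rcases h' with rfl | ⟨c', d', h', H'⟩
  · exact Or.inr ⟨c, d, h, H⟩
  obtain ⟨e, he⟩ := c.exists_comp c'
  obtain ⟨f, hf⟩ := d'.exists_comp d
  refine Or.inr ⟨e, f, ⟨fun x hx => ?_, fun y hy => ?_⟩, fun t ht x hx => ?_⟩
  · have h1 := h.1 x hx
    have h2 := h'.1 _ h1.1
    rw [he, hf, h2.2, h1.2]
    exact ⟨h2.1, rfl⟩
  · have h1 := h'.2 y hy
    have h2 := h.2 _ h1.1
    rw [he, hf, h2.2, h1.2]
    exact ⟨h2.1, rfl⟩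
  · have h1 := h.1 x hx
    have h2 := H' t ht _ h1.1
    rw [← h.rdot_eq hO hO' hx h1.1] at h2
    rw [he]
    exact (H t ht x hx).trans h2

lemma Level.finite [Finite A] (n : ℕ) {O : Set (ℤ → A)} (hO : IsToeplitzShift O) :
    {O' : Set (ℤ → A) | IsToeplitzShift O' ∧ Level n O O'}.Finite := by
  obtain ⟨x, -, hxO⟩ := id hO
  have hx : x ∈ O := hxO ▸ self_mem_orbitClosure x
  by_cases hgap : (GapStart (rdot A x n) x).Nonempty
  · obtain ⟨s, hs⟩ := hgap
    refine ((Set.finite_range fun φ => orbitClosure A (blockRecode (rdot_pos x n) s x φ)).insert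
      O).subset ?_
    rintro O' ⟨hO', rfl | ⟨c, d, h, H⟩⟩
    · exact Set.mem_insert _ _
    · obtain ⟨φ, k, hφ⟩ := (H n le_rfl x hx).2.1.exists_blockRecode (rdot_pos x n) hs
      refine Or.inr ⟨φ, ?_⟩
      simp only [← hφ]
      exact hO'.orbitClosure_eq (hO'.shiftBy_mem (h.1 x hx).1 k)
  · refine (Set.finite_singleton O).subset ?_
    rintro O' ⟨hO', rfl | ⟨c, d, h, H⟩⟩
    · rfl
    · exact absurd (H n le_rfl x hx).1 hgap

end Levels

section SequenceMeasurability

variable {A : Type} [Countable A] [MeasurableSpace A] [MeasurableSingletonClass A]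

lemma measurable_apply_eq (i j : ℤ) : Measurable fun x : ℤ → A => x i = x j :=
  measurableSet_setOfPred.1
    (measurableSet_eq_fun (measurable_pi_apply i) (measurable_pi_apply j))

lemma measurable_mem_Per (r : ℕ) (i : ℤ) : Measurable fun x : ℤ → A => i ∈ Per A r x :=
  Measurable.forall fun k => measurable_apply_eq (i + r * k) i

lemma measurable_isEssentialPeriod (e : ℕ) :
    Measurable fun x : ℤ → A => IsEssentialPeriod A x e := by
  simp only [IsEssentialPeriod, Set.Nonempty, ne_eq, Set.ext_iff]
  refine measurable_const.and ((Measurable.exists fun i => measurable_mem_Per e i).and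
    (Measurable.forall fun q => measurable_const.imp (measurable_const.imp
      (Measurable.forall fun i => ?_).not)))
  exact (measurable_mem_Per e i).iff (measurable_mem_Per q i)

lemma measurable_rdot (t : ℕ) : Measurable fun x : ℤ → A => rdot A x t := by
  refine Finset.measurable_prod _ fun i _ => ?_
  refine (measurable_from_nat (f := fun n => Nat.nth Nat.Prime i ^ n)).comp ?_
  let g : (Fin (t + 2) → Prop) → ℕ := fun v => sSup {j : ℕ | ∃ h : j < t + 2, v ⟨j, h⟩}
  have hg : Measurable g := Measurable.of_discrete
  have : (fun x : ℤ → A => sSup {j : ℕ | j ≤ t + 1 ∧ ∃ e : ℕ, IsEssentialPeriod A x e ∧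
      Nat.nth Nat.Prime i ^ j ∣ e}) = fun x => g fun j => ∃ e : ℕ, IsEssentialPeriod A x e ∧
      Nat.nth Nat.Prime i ^ (j : ℕ) ∣ e := by
    funext x
    simp only [g]
    congr 1
    ext j
    simp only [Set.mem_ofPred_eq, exists_prop, Nat.lt_succ_iff]
  rw [this]
  refine hg.comp (measurable_pi_lambda (fun (x : ℤ → A) (j : Fin (t + 2)) => ∃ e : ℕ,
    IsEssentialPeriod A x e ∧ Nat.nth Nat.Prime i ^ (j : ℕ) ∣ e) fun j => Measurable.exists fun e =>
      (measurable_isEssentialPeriod (A := A) e).and measurable_const)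

lemma measurable_of_rdot {P : ℕ → (ℤ → A) → Prop} (h : ∀ r, 0 < r → Measurable (P r)) (t : ℕ) :
    Measurable fun x => P (rdot A x t) x := by
  have : (fun x => P (rdot A x t) x) = fun x => ∃ r : {r : ℕ // 0 < r}, rdot A x t = r ∧ P r x := by
    funext x
    refine propext ⟨fun hx => ⟨⟨_, rdot_pos x t⟩, rfl, hx⟩, ?_⟩
    rintro ⟨r, hr, hx⟩
    rwa [hr]
  rw [this]
  exact Measurable.exists fun r => (measurableSet_setOfPred.1 (measurableSet_eq_fun
    (measurable_rdot t) measurable_const)).and (h r r.2)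

lemma measurable_mem_GapStart (r : ℕ) (s : ℤ) : Measurable fun x : ℤ → A => s ∈ GapStart r x :=
  (measurable_mem_Per r (s - 1)).and (measurable_mem_Per r s).not

lemma measurable_growing : Measurable fun x : ℤ → A => Growing x :=
  Measurable.forall fun L => Measurable.exists fun _ => Measurable.forall fun t =>
    measurable_const.imp (measurable_of_rdot (P := fun r x => LongBlocks L r x) (fun r _ => Measurable.forall fun s =>
      (measurable_mem_GapStart r s).imp (Measurable.forall fun i =>
        measurable_const.imp (measurable_const.imp (measurable_mem_Per r i)))) t)

lemma measurable_blockConj {Ω : Type*} [MeasurableSpace Ω] {r : ℕ} (hr : 0 < r)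
    {f g : Ω → ℤ → A} (hf : Measurable f) (hg : Measurable g) :
    Measurable fun w => BlockConj r (f w) (g w) := by
  have := countable_equivariant hr
  have hrep : ∀ {f : Ω → ℤ → A} (_ : Measurable f) (a b n : ℤ),
      Measurable fun w => ∀ i, a ≤ i → i < b → f w (i + r * n) = f w i := fun hf a b n =>
    Measurable.forall fun i => measurable_const.imp (measurable_const.imp
      ((measurable_apply_eq (i + r * n) i).comp hf))
  refine Measurable.exists fun h => (Measurable.forall fun s => ?_).and
    (Measurable.forall fun s => ?_)
  · exact ((measurable_mem_GapStart r s).comp hf).imp ((measurable_mem_GapStart r (h.1 s)).comp hg)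
  · refine ((measurable_mem_GapStart r s).comp hf).imp (Measurable.forall fun s' =>
      ((measurable_mem_GapStart r s').comp hf).imp (measurable_const.imp
        (Measurable.forall fun n => (hrep hf _ _ n).iff (hrep hg _ _ n))))

lemma measurable_comparable {r : ℕ} (hr : 0 < r) {f : (ℤ → A) → ℤ → A} (hf : Measurable f) :
    Measurable fun x => Comparable r x (f x) :=
  (Measurable.exists fun s => measurable_mem_GapStart r s).and
    ((measurable_blockConj hr measurable_id hf).and (measurable_blockConj hr hf measurable_id))

end SequenceMeasurability

section Characterization

variable {A : Type} [TopologicalSpace A] [DiscreteTopology A]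

lemma isToeplitzShift_iff [Finite A] {K : Set (ℤ → A)} (hK : IsCompact K) (hne : K.Nonempty)
    {B : Set (Set (ℤ → A))} (hB : IsTopologicalBasis B) :
    IsToeplitzShift K ↔
      (∀ x ∈ K, shiftBy 1 x ∈ K) ∧
      (∀ U ∈ B, (K ∩ U).Nonempty → K ⊆ ⋃ n : ℕ, shiftBy n ⁻¹' U) ∧
      (∀ n : ℕ, ∀ U ∈ B, (K ∩ U).Nonempty → ∃ p : ℕ, 1 ≤ p ∧ ∃ V ∈ B, V ⊆ U ∧ (K ∩ V).Nonempty ∧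
        ∀ y ∈ K ∩ V, ∀ i : ℤ, -n ≤ i → i ≤ n → i ∈ Per A p y) ∧
      ∀ p : ℕ, 1 ≤ p → ∃ y ∈ K, shiftBy p y ≠ y := by
  constructor
  · intro hT
    have hmin : ∀ U, IsOpen U → (K ∩ U).Nonempty → K ⊆ ⋃ n : ℕ, shiftBy n ⁻¹' U := by
      rintro U hU ⟨x, hx, hxU⟩ y hy
      rw [← hT.orbitClosure_eq hy, orbitClosure_eq] at hx
      obtain ⟨_, hz, n, rfl⟩ := mem_closure_iff.1 hx U hU hxU
      exact mem_iUnion.2 ⟨n, hz⟩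
    refine ⟨fun x hx => hT.shiftBy_mem hx 1, fun U hU => hmin U (hB.isOpen hU),
      fun n U hU hne => ?_, fun p hp => ?_⟩
    · obtain ⟨w, hw, hwK⟩ := id hT
      have hwK' : w ∈ K := hwK ▸ self_mem_orbitClosure w
      obtain ⟨k, hk⟩ := mem_iUnion.1 (hmin U (hB.isOpen hU) hne hwK')
      have hzK := hT.shiftBy_mem hwK' k
      obtain ⟨p, hp, hper⟩ := (hw.shift k).exists_period (Finset.Icc (-(n : ℤ)) n)
      obtain ⟨N, hN⟩ := exists_window hp (shiftBy k w)
      obtain ⟨V, hV, hzV, hVsub⟩ := hB.exists_subset_of_mem_open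
        (show shiftBy k w ∈ U ∩ {z | ∀ i ∈ Finset.Icc (-(N : ℤ)) N, z i = shiftBy k w i} from
          ⟨hk, fun _ _ => rfl⟩)
        ((hB.isOpen hU).inter (isOpen_cylinder _ _))
      refine ⟨p, hp, V, hV, fun y hy => (hVsub hy).1, ⟨_, hzK, hzV⟩, fun y hy i h1 h2 => ?_⟩
      obtain ⟨d, -, hd⟩ := hT.exists_translate hp hzK hy.1
      rw [(hN y (fun i h1 h2 => (hVsub hy.2).2 i (Finset.mem_Icc.2 ⟨h1, h2⟩))
        ⟨d, fun i => by rw [hd, mem_Per_shiftBy]⟩).1]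
      exact hper i (Finset.mem_Icc.2 ⟨h1, h2⟩)
    · obtain ⟨w, hw, rfl⟩ := hT
      exact ⟨w, self_mem_orbitClosure w, fun h => hw.1 ⟨p, hp, fun i => congrFun h i⟩⟩
  · rintro ⟨hinv, hmin, hper, hnon⟩
    have : CompactSpace K := isCompact_iff_compactSpace.1 hK
    have : Nonempty K := hne.to_subtype
    let D : ℕ → Set K := fun n => {x | ∃ p : ℕ, 1 ≤ p ∧ ∃ V ∈ B, x.1 ∈ V ∧
        ∀ y ∈ K ∩ V, ∀ i : ℤ, -n ≤ i → i ≤ n → i ∈ Per A p y}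
    have hDo : ∀ n, IsOpen (D n) := by
      intro n
      rw [isOpen_iff_mem_nhds]
      rintro x ⟨p, hp, V, hV, hxV, h⟩
      filter_upwards [((hB.isOpen hV).preimage continuous_subtype_val).mem_nhds hxV] with y hy
      exact ⟨p, hp, V, hV, hy, h⟩
    have hDd : ∀ n, Dense (D n) := by
      intro n x
      rw [mem_closure_iff]
      intro o ho hx
      obtain ⟨o', ho', rfl⟩ := isOpen_induced_iff.1 ho
      obtain ⟨U, hU, hxU, hsub⟩ := hB.exists_subset_of_mem_open hx ho'
      obtain ⟨p, hp, V, hV, hVU, ⟨y, hyK, hyV⟩, h⟩ := hper n U hU ⟨x, x.2, hxU⟩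
      exact ⟨⟨y, hyK⟩, hsub (hVU hyV), p, hp, V, hV, hyV, h⟩
    obtain ⟨⟨w, hwK⟩, hw⟩ := (dense_iInter_of_isOpen_nat hDo hDd).nonempty
    have hwn : ∀ n : ℕ, ∃ p : ℕ, 1 ≤ p ∧ ∀ i : ℤ, -n ≤ i → i ≤ n → i ∈ Per A p w := by
      intro n
      obtain ⟨p, hp, V, hV, hwV, h⟩ := mem_iInter.1 hw n
      exact ⟨p, hp, h w ⟨hwK, hwV⟩⟩
    have horbit : K = orbitClosure A w := by
      rw [orbitClosure_eq]
      apply Set.Subset.antisymm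
      · intro x hx
        rw [mem_closure_iff]
        intro o ho hxo
        obtain ⟨U, hU, hxU, hsub⟩ := hB.exists_subset_of_mem_open hxo ho
        obtain ⟨n, hn⟩ := mem_iUnion.1 (hmin U hU ⟨x, hx, hxU⟩ hwK)
        exact ⟨_, hsub hn, n, rfl⟩
      · refine closure_minimal ?_ hK.isClosed
        rintro _ ⟨n, rfl⟩
        induction n with
        | zero =>
          have : shiftBy ((0 : ℕ) : ℤ) w = w := by
            ext i
            simp [shiftBy]
          change shiftBy ((0 : ℕ) : ℤ) w ∈ K
          rwa [this]
        | succ n ih =>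
          have := hinv _ ih
          simp only [shiftBy_shiftBy] at this
          push_cast
          rwa [add_comm]
    refine ⟨w, ⟨?_, fun i => ?_⟩, horbit⟩
    · rintro ⟨p, hp, h⟩
      obtain ⟨y, hyK, hy⟩ := hnon p hp
      have hsub : K ⊆ {y | shiftBy p y = y} := by
        rw [horbit, orbitClosure_eq]
        refine closure_minimal ?_ (isClosed_eq (continuous_shiftBy _) continuous_id)
        rintro _ ⟨n, rfl⟩
        ext i
        simp only [shiftBy]
        rw [add_right_comm]
        exact h _
      exact hy (hsub hyK)
    · obtain ⟨p, hp, h⟩ := hwn i.natAbs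
      exact ⟨p, hp, fun k => by rw [mul_comm]; exact h i (by omega) (by omega) k⟩

end Characterization

section Hyperspace

variable {A : Type} [Fintype A] [MetricSpace A]

instance : BorelSpace (NonemptyCompacts (ℤ → A)) := ⟨rfl⟩

instance : PolishSpace (NonemptyCompacts (ℤ → A) × NonemptyCompacts (ℤ → A)) := {}

omit [Fintype A] in
lemma measurable_hits {U : Set (ℤ → A)} (hU : IsOpen U) :
    Measurable fun K : NonemptyCompacts (ℤ → A) => ((K : Set (ℤ → A)) ∩ U).Nonempty :=
  measurableSet_setOfPred.1 (NonemptyCompacts.isOpen_inter_nonempty_of_isOpen hU).measurableSet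

omit [Fintype A] in
lemma measurable_forall_mem_isClosed {F : Set (ℤ → A)} (hF : IsClosed F) :
    Measurable fun K : NonemptyCompacts (ℤ → A) => ∀ x ∈ K, x ∈ F :=
  measurableSet_setOfPred.1 (NonemptyCompacts.isClosed_subsets_of_isClosed hF).measurableSet

lemma measurable_forall_map_mem {f : (ℤ → A) → ℤ → A} (hf : Continuous f) :
    Measurable fun p : NonemptyCompacts (ℤ → A) × NonemptyCompacts (ℤ → A) =>
      ∀ x ∈ p.1, f x ∈ p.2 := by
  have hB := isBasis_countableBasis (ℤ → A)
  have : (fun p : NonemptyCompacts (ℤ → A) × NonemptyCompacts (ℤ → A) =>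
      ∀ x ∈ p.1, f x ∈ p.2) = fun p => ∀ U : countableBasis (ℤ → A),
        ((p.1 : Set (ℤ → A)) ∩ f ⁻¹' U).Nonempty → ((p.2 : Set (ℤ → A)) ∩ U).Nonempty := by
    funext p
    refine propext ⟨fun h U ⟨x, hx, hxU⟩ => ⟨f x, h x hx, hxU⟩, fun h x hx => ?_⟩
    by_contra hcon
    obtain ⟨U, hU, hxU, hsub⟩ := hB.exists_subset_of_mem_open
      (show f x ∈ (p.2 : Set (ℤ → A))ᶜ from hcon) p.2.isCompact.isClosed.isOpen_compl
    obtain ⟨y, hy, hyU⟩ := h ⟨U, hU⟩ ⟨x, hx, hxU⟩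
    exact hsub hyU hy
  rw [this]
  exact Measurable.forall fun U =>
    ((measurable_hits ((hB.isOpen U.2).preimage hf)).comp measurable_fst).imp
      ((measurable_hits (hB.isOpen U.2)).comp measurable_snd)

lemma measurable_codeConj (c d : Code A) :
    Measurable fun p : NonemptyCompacts (ℤ → A) × NonemptyCompacts (ℤ → A) =>
      CodeConj c d p.1 p.2 := by
  have key : ∀ c d : Code A,
      Measurable fun p : NonemptyCompacts (ℤ → A) × NonemptyCompacts (ℤ → A) =>
        ∀ x ∈ (p.1 : Set (ℤ → A)), c.map x ∈ (p.2 : Set (ℤ → A)) ∧ d.map (c.map x) = x := by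
    intro c d
    have h1 := (measurable_forall_map_mem c.continuous).and ((measurable_forall_mem_isClosed
      (isClosed_eq (d.continuous.comp c.continuous) continuous_id)).comp
        (measurable_fst (β := NonemptyCompacts (ℤ → A))))
    refine (congrArg Measurable (funext fun p => propext ?_)).mpr h1
    exact forall₂_and
  exact (key c d).and ((key d c).comp measurable_swap)

lemma measurable_isToeplitzShift :
    Measurable fun K : NonemptyCompacts (ℤ → A) => IsToeplitzShift (K : Set (ℤ → A)) := by
  have hB := isBasis_countableBasis (ℤ → A)
  have : (fun K : NonemptyCompacts (ℤ → A) => IsToeplitzShift (K : Set (ℤ → A))) =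
    fun K : NonemptyCompacts (ℤ → A) =>
      (∀ x ∈ K, shiftBy 1 x ∈ K) ∧
      (∀ U : countableBasis (ℤ → A), ((K : Set (ℤ → A)) ∩ U).Nonempty →
        (K : Set (ℤ → A)) ⊆ ⋃ n : ℕ, shiftBy n ⁻¹' (U : Set (ℤ → A))) ∧
      (∀ n : ℕ, ∀ U : countableBasis (ℤ → A), ((K : Set (ℤ → A)) ∩ U).Nonempty →
        ∃ p : ℕ, 1 ≤ p ∧ ∃ V : countableBasis (ℤ → A), V.1 ⊆ U.1 ∧
        ((K : Set (ℤ → A)) ∩ V).Nonempty ∧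
        ¬ ((K : Set (ℤ → A)) ∩ (V.1 ∩ {y | ∃ i : ℤ, -n ≤ i ∧ i ≤ n ∧ i ∉ Per A p y})).Nonempty) ∧
      ∀ p : ℕ, 1 ≤ p → ((K : Set (ℤ → A)) ∩ {y | shiftBy p y ≠ y}).Nonempty := by
    funext K
    rw [isToeplitzShift_iff K.isCompact K.nonempty hB]
    simp only [Subtype.forall, Subtype.exists, Set.mem_inter_iff, Set.mem_ofPred_eq, not_and, not_exists,
      not_not, exists_prop, and_imp, SetLike.mem_coe, Set.Nonempty, ne_eq]
  rw [this]
  have hPer : ∀ (p : ℕ) (i : ℤ), IsClosed {y : ℤ → A | i ∈ Per A p y} := by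
    intro p i
    have : {y : ℤ → A | i ∈ Per A p y} = ⋂ k : ℤ, {y | y (i + p * k) = y i} := by
      ext y
      simp [Per]
    rw [this]
    exact isClosed_iInter fun k => isClosed_eq (continuous_apply _) (continuous_apply _)
  refine ((measurable_forall_map_mem (continuous_shiftBy 1)).comp
    (measurable_id.prodMk measurable_id)).and ((Measurable.forall fun U =>
      (measurable_hits (hB.isOpen U.2)).imp ?_).and ((Measurable.forall fun n =>
        Measurable.forall fun U => (measurable_hits (hB.isOpen U.2)).imp (Measurable.exists fun p =>
          measurable_const.and (Measurable.exists fun V => measurable_const.and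
            ((measurable_hits (hB.isOpen V.2)).and (measurable_hits ?_).not)))).and
      (Measurable.forall fun p => measurable_const.imp (measurable_hits ?_))))
  · exact measurableSet_setOfPred.1 (NonemptyCompacts.isOpen_subsets_of_isOpen
      (isOpen_iUnion fun n : ℕ => (hB.isOpen U.2).preimage (continuous_shiftBy (n : ℤ)))).measurableSet
  · refine (hB.isOpen V.2).inter ?_
    simp only [Set.ofPred_exists, Set.ofPred_and]
    exact isOpen_iUnion fun i => isOpen_const.inter (isOpen_const.inter (hPer p i).isOpen_compl)
  · exact isOpen_ne_fun (continuous_shiftBy p) continuous_id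

variable [MeasurableSpace A] [BorelSpace A]

/-- A fibrewise condition that holds everywhere on a fibre once it holds somewhere is Borel. -/
lemma measurableSet_forall_mem {X : Type*} [TopologicalSpace X] [PolishSpace X]
    [MeasurableSpace X] [BorelSpace X] {W : Set X} (hW : MeasurableSet W)
    {f : X → NonemptyCompacts (ℤ → A)} (hf : Measurable f) {P : (ℤ → A) → Prop}
    (hP : Measurable P) (H : ∀ w ∈ W, (∃ x ∈ f w, P x) → ∀ x ∈ f w, P x) :
    MeasurableSet {w | w ∈ W ∧ ∀ x ∈ f w, P x} := by
  have hB := isBasis_countableBasis (ℤ → A)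
  have hmem : Measurable fun q : X × (ℤ → A) => q.2 ∈ f q.1 := by
    have : (fun q : X × (ℤ → A) => q.2 ∈ f q.1) = fun q => ∀ U : countableBasis (ℤ → A),
        q.2 ∈ U.1 → ((f q.1 : Set (ℤ → A)) ∩ U).Nonempty := by
      funext q
      refine propext ⟨fun h U hU => ⟨_, h, hU⟩, fun h => ?_⟩
      by_contra hcon
      obtain ⟨U, hU, hxU, hsub⟩ := hB.exists_subset_of_mem_open
        (show q.2 ∈ (f q.1 : Set (ℤ → A))ᶜ from hcon) (f q.1).isCompact.isClosed.isOpen_compl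
      obtain ⟨y, hy, hyU⟩ := h ⟨U, hU⟩ hxU
      exact hsub hyU hy
    rw [this]
    exact Measurable.forall fun U =>
      ((measurable_mem.2 (hB.isOpen U.2).measurableSet).comp measurable_snd).imp
        ((measurable_hits (hB.isOpen U.2)).comp (hf.comp measurable_fst))
  have h1 : MeasurableSet {q : X × (ℤ → A) | q.1 ∈ W ∧ q.2 ∈ f q.1 ∧ P q.2} :=
    measurableSet_setOfPred.2 (((measurable_mem.2 hW).comp measurable_fst).and
      (hmem.and (hP.comp measurable_snd)))
  have h2 : MeasurableSet {q : X × (ℤ → A) | q.1 ∈ W → q.2 ∈ f q.1 ∧ ¬ P q.2} :=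
    measurableSet_setOfPred.2 (((measurable_mem.2 hW).comp measurable_fst).imp
      (hmem.and (hP.comp measurable_snd).not))
  have e1 : {w | w ∈ W ∧ ∀ x ∈ f w, P x} =
      Prod.fst '' {q : X × (ℤ → A) | q.1 ∈ W ∧ q.2 ∈ f q.1 ∧ P q.2} := by
    ext w
    constructor
    · rintro ⟨hw, h⟩
      obtain ⟨x, hx⟩ := (f w).nonempty
      exact ⟨(w, x), ⟨hw, hx, h x hx⟩, rfl⟩
    · rintro ⟨⟨w, x⟩, ⟨hw, hx, h⟩, rfl⟩
      exact ⟨hw, H w hw ⟨x, hx, h⟩⟩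
  have e2 : {w | w ∈ W ∧ ∀ x ∈ f w, P x}ᶜ =
      Prod.fst '' {q : X × (ℤ → A) | q.1 ∈ W → q.2 ∈ f q.1 ∧ ¬ P q.2} := by
    ext w
    constructor
    · intro h
      by_contra hcon
      have hx : ∀ x, w ∈ W ∧ (x ∈ f w → P x) := fun x => by
        by_contra hx
        exact hcon ⟨(w, x), fun hw => by tauto, rfl⟩
      obtain ⟨x, -⟩ := (f w).nonempty
      exact h ⟨(hx x).1, fun x => (hx x).2⟩
    · rintro ⟨⟨w, x⟩, hx, rfl⟩ ⟨hw, hall⟩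
      exact (hx hw).2 (hall x (hx hw).1)
  refine MeasureTheory.AnalyticSet.measurableSet_of_compl ?_ ?_
  · rw [e1]
    exact h1.analyticSet.image_of_continuous continuous_fst
  · rw [e2]
    exact h2.analyticSet.image_of_continuous continuous_fst

omit [MeasurableSpace A] [BorelSpace A] [Fintype A] in
lemma mem_toeplitzGrowingBlocks_iff [DiscreteTopology A] {K : NonemptyCompacts (ℤ → A)} :
    K ∈ ToeplitzGrowingBlocks A ↔ IsToeplitzShift (K : Set (ℤ → A)) ∧ ∀ x ∈ K, Growing x := by
  constructor
  · rintro ⟨w, hw, hwK, hg⟩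
    have hK : IsToeplitzShift (K : Set (ℤ → A)) := ⟨w, hw, hwK⟩
    have hwK' : w ∈ (K : Set (ℤ → A)) := hwK ▸ self_mem_orbitClosure w
    exact ⟨hK, fun x hx => hK.growing hwK' hx (hw.hasGrowingBlocks_iff.1 hg)⟩
  · rintro ⟨⟨w, hw, hwK⟩, hg⟩
    have hwK' : w ∈ (K : Set (ℤ → A)) := hwK ▸ self_mem_orbitClosure w
    exact ⟨w, hw, hwK, hw.hasGrowingBlocks_iff.2 (hg w hwK')⟩

lemma measurableSet_toeplitzGrowingBlocks : MeasurableSet (ToeplitzGrowingBlocks A) := by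
  have : ToeplitzGrowingBlocks A = {K | K ∈ {K : NonemptyCompacts (ℤ → A) |
      IsToeplitzShift (K : Set (ℤ → A))} ∧ ∀ x ∈ id K, Growing x} := by
    ext K
    exact mem_toeplitzGrowingBlocks_iff
  rw [this]
  refine measurableSet_forall_mem (measurableSet_setOfPred.2 measurable_isToeplitzShift)
    measurable_id measurable_growing ?_
  rintro K hK ⟨x, hx, hg⟩ y hy
  exact IsToeplitzShift.growing hK hx hy hg

lemma measurable_level (n : ℕ) :
    Measurable fun p : ToeplitzGrowingBlocks A × ToeplitzGrowingBlocks A =>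
      Level n (p.1.1 : Set (ℤ → A)) (p.2.1 : Set (ℤ → A)) := by
  let W : Code A → Code A → Set (NonemptyCompacts (ℤ → A) ×
      NonemptyCompacts (ℤ → A)) := fun c d => {p | IsToeplitzShift (p.1 : Set (ℤ → A)) ∧
    IsToeplitzShift (p.2 : Set (ℤ → A)) ∧ CodeConj c d p.1 p.2}
  have hW : ∀ c d, MeasurableSet (W c d) := fun c d =>
    measurableSet_setOfPred.2 ((measurable_isToeplitzShift.comp measurable_fst).and
      ((measurable_isToeplitzShift.comp measurable_snd).and (measurable_codeConj c d)))
  have hS : ∀ (c d : Code A) (t : ℕ), MeasurableSet {p | p ∈ W c d ∧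
      ∀ x ∈ p.1, Comparable (rdot A x t) x (c.map x)} := by
    intro c d t
    refine measurableSet_forall_mem (hW c d) measurable_fst
      (measurable_of_rdot (fun r hr => measurable_comparable hr c.continuous.measurable) t) ?_
    rintro p ⟨h1, h2, h⟩ ⟨x₀, hx₀, H⟩ x hx
    rw [h1.rdot_eq hx₀ hx t] at H
    exact h.comparable h1 h2 (rdot_pos _ _) hx hx₀ H
  have hφ : Measurable fun p : ToeplitzGrowingBlocks A × ToeplitzGrowingBlocks A =>
      (p.1.1, p.2.1) :=
    (measurable_subtype_coe.comp measurable_fst).prodMk (measurable_subtype_coe.comp measurable_snd)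
  have key : (fun p : ToeplitzGrowingBlocks A × ToeplitzGrowingBlocks A =>
      Level n (p.1.1 : Set (ℤ → A)) (p.2.1 : Set (ℤ → A))) = fun p =>
      p.1.1 = p.2.1 ∨ ∃ c d, (p.1.1, p.2.1) ∈ W c d ∧ ∀ t, n ≤ t →
        (p.1.1, p.2.1) ∈ {p | p ∈ W c d ∧
          ∀ x ∈ p.1, Comparable (rdot A x t) x (c.map x)} := by
    funext ⟨O, O'⟩
    have hO := (mem_toeplitzGrowingBlocks_iff.1 O.2).1
    have hO' := (mem_toeplitzGrowingBlocks_iff.1 O'.2).1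
    refine propext (or_congr SetLike.coe_set_eq (exists₂_congr fun c d => ?_))
    exact ⟨fun ⟨h, H⟩ => ⟨⟨hO, hO', h⟩, fun t ht => ⟨⟨hO, hO', h⟩, H t ht⟩⟩,
      fun ⟨h, H⟩ => ⟨h.2.2, fun t ht => (H t ht).2⟩⟩
  rw [key]
  refine Measurable.or ?_ (Measurable.exists fun c => Measurable.exists fun d =>
    ((measurable_mem.2 (hW c d)).comp hφ).and (Measurable.forall fun t => measurable_const.imp
      ((measurable_mem.2 (hS c d t)).comp hφ)))
  exact measurableSet_setOfPred.1 (measurableSet_eq_fun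
    (measurable_subtype_coe.comp measurable_fst) (measurable_subtype_coe.comp measurable_snd))

end Hyperspace

/-- `T**` is a Borel subset of `K(𝔫^ℤ)` and the topological conjugacy relation
on `T**` is hyperfinite: it is the union of an increasing sequence of finite Borel
equivalence relations. -/
theorem stmt1 (A : Type) [Fintype A] [MetricSpace A] (h2 : 2 ≤ Fintype.card A) :
    MeasurableSet (ToeplitzGrowingBlocks A) ∧
    ∃ F : ℕ → ToeplitzGrowingBlocks A → ToeplitzGrowingBlocks A → Prop,
      (∀ n, Equivalence (F n)) ∧
      (∀ n, MeasurableSet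
        {p : ToeplitzGrowingBlocks A × ToeplitzGrowingBlocks A | F n p.1 p.2}) ∧
      (∀ n O, {O' : ToeplitzGrowingBlocks A | F n O O'}.Finite) ∧
      (∀ n O O', F n O O' → F (n + 1) O O') ∧
      (∀ O O' : ToeplitzGrowingBlocks A,
        (∃ n, F n O O') ↔ IsTopConj A ((O : NonemptyCompacts (ℤ → A)) : Set (ℤ → A))
          ((O' : NonemptyCompacts (ℤ → A)) : Set (ℤ → A))) := by
  let _ : MeasurableSpace A := borel A
  have : BorelSpace A := ⟨rfl⟩
  have hT : ∀ O : ToeplitzGrowingBlocks A, IsToeplitzShift (O.1 : Set (ℤ → A)) :=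
    fun O => (mem_toeplitzGrowingBlocks_iff.1 O.2).1
  have hg : ∀ O : ToeplitzGrowingBlocks A, ∀ x ∈ (O.1 : Set (ℤ → A)), Growing x :=
    fun O => (mem_toeplitzGrowingBlocks_iff.1 O.2).2
  refine ⟨measurableSet_toeplitzGrowingBlocks,
    fun n O O' => Level n (O.1 : Set (ℤ → A)) (O'.1 : Set (ℤ → A)), fun n => ?_,
    fun n => measurableSet_setOfPred.2 (measurable_level n), fun n O => ?_,
    fun n O O' h => h.succ, fun O O' => ?_⟩
  · exact ⟨fun O => Or.inl rfl, fun {O O'} h => h.symm (hT O) (hT O'),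
      fun {O O' O''} h h' => h.trans (hT O) (hT O') h'⟩
  · refine ((Level.finite n (hT O)).preimage (f := fun O' : ToeplitzGrowingBlocks A =>
      (O'.1 : Set (ℤ → A))) ?_).subset fun O' h => ⟨hT O', h⟩
    exact (SetLike.coe_injective.comp Subtype.val_injective).injOn
  · rw [isTopConj_iff O.1.isCompact O'.1.isCompact (fun x hx => (hT O).shiftBy_mem hx)
      fun x hx => (hT O').shiftBy_mem hx]
    constructor
    · rintro ⟨n, h | ⟨c, d, h, -⟩⟩
      · rw [← h]
        let c : Code A := ⟨0, fun B => B ⟨0, by simp⟩⟩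
        have hid : ∀ x, c.map x = x := fun x => by
          ext i
          simp [c, Code.map]
        exact ⟨c, c, fun x hx => by rw [hid, hid]; exact ⟨hx, rfl⟩,
          fun x hx => by rw [hid, hid]; exact ⟨hx, rfl⟩⟩
      · exact ⟨c, d, h⟩
    · rintro ⟨c, d, h⟩
      obtain ⟨n, hn⟩ := h.exists_comparable (hT O) (hT O') (hg O) (hg O')
      exact ⟨n, Or.inr ⟨c, d, h, hn⟩⟩
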